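/- arXiv:0901.4800 — 3 statements merged into one kernel-verified Lean document; each statement's English description precedes it below -/
import Mathlib

section
/- Let K ∈ C²((0,∞)², ℝ) be such that for all k ∈ ℕ and all x₁,…,x_k > 0 the matrix (K(x_i,x_j))_{1≤i,j≤k} is symmetric and positive semidefinite, and suppose there is α > 1/2 such that for every x₀ > 0 there is C(x₀) with |∂^{p+q}K/∂x^p∂y^q (x,y)| ≤ C(x₀)/(xy)^α for all x,y ≥ x₀ and all p+q ≤ 2. Set ρ_k(x₁,…,x_k) = det(K(x_i,x_j))_{1≤i,j≤k}. Then for every t > 0, ∑_{k≥1} (1/k!) ∫_{(t,∞)^k} ρ_k(x₁,…,x_k) dx₁⋯dx_k < ∞; the Fredholm determinant F(t) = 1 + ∑_{k≥1} ((−1)^k/k!) ∫_{(t,∞)^k} ρ_k dx₁⋯dx_k is C³ on (0,∞); and its derivatives are F′(t) = ∑_{k≥0} ((−1)^k/k!) ∫_{(t,∞)^k} ρ_{k+1}(t,x₁,…,x_k) dx₁⋯dx_k, F″(t) = ∑_{k≥0} ((−1)^k/k!) ∫_{(t,∞)^k} (∂/∂t)ρ_{k+1}(t,x₁,…,x_k)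 dx₁⋯dx_k, and F‴(t) = ∑_{k≥0} ((−1)^k/k!) ∫_{(t,∞)^k} (∂²/∂t²)ρ_{k+1}(t,x₁,…,x_k) dx₁⋯dx_k, where all these sums and integrals converge absolutely. -/
noncomputable section

open Complex MeasureTheory Filter Set

/-- Rising Pochhammer symbol `(x)_n = x(x+1)⋯(x+n−1)`. -/
def poch (x : ℂ) (n : ℕ) : ℂ := ∏ i ∈ Finset.range n, (x + i)

/-- Confluent hypergeometric series `₁F₁[r, q; z]`. -/
def oneF1 (r q z : ℂ) : ℂ := ∑' n : ℕ, poch r n / (poch q n * n.factorial) * z ^ n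

/-- Terminating Gauss hypergeometric series `₂F₁[−m, b, c; z]`. -/
def twoF1neg (m : ℕ) (b c z : ℂ) : ℂ :=
  ∑ k ∈ Finset.range (m + 1),
    poch (-(m : ℂ)) k * poch b k / (poch c k * (k.factorial : ℂ)) * z ^ k

/-- The common prefactor `|2/x|^{Re s} e^{−i/x + π Im(s) Sgn(x)/2}`. -/
def prefac (s : ℂ) (x : ℝ) : ℂ :=
  ((|2 / x| ^ s.re : ℝ) : ℂ) *
    Complex.exp (-Complex.I / (x : ℂ) + ((Real.pi * s.im * Real.sign x / 2 : ℝ) : ℂ))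

/-- `P̃(x) = |2/x|^{Re s} e^{−i/x + π Im(s) Sgn(x)/2} ₁F₁[s, 2Re(s)+1; 2i/x]`. -/
def Ptilde (s : ℂ) (x : ℝ) : ℂ :=
  prefac s x * oneF1 s ((2 * s.re + 1 : ℝ) : ℂ) (2 * Complex.I / (x : ℂ))

/-- `Q(x) = (2/x)|2/x|^{Re s} e^{−i/x + π Im(s) Sgn(x)/2} ₁F₁[s+1, 2Re(s)+2; 2i/x]`. -/
def Qfun (s : ℂ) (x : ℝ) : ℂ :=
  (2 / (x : ℂ)) * prefac s x * oneF1 (s + 1) ((2 * s.re + 2 : ℝ) : ℂ) (2 * Complex.I / (x : ℂ))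

/-- The constant in front of the limiting kernel `K_∞`. -/
def cinf (s : ℂ) : ℂ :=
  (1 / (2 * (Real.pi : ℂ))) *
    (Complex.Gamma (s + 1) * Complex.Gamma ((starRingEnd ℂ) s + 1) /
      (Complex.Gamma ((2 * s.re + 1 : ℝ) : ℂ) * Complex.Gamma ((2 * s.re + 2 : ℝ) : ℂ)))

/-- The limiting kernel `K_∞`, as a complex number (it is in fact real). -/
def KinfC (s : ℂ) (x y : ℝ) : ℂ :=
  if x = y then cinf s * (deriv (Ptilde s) x * Qfun s x - deriv (Qfun s) x * Ptilde s x)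
  else cinf s * (Ptilde s x * Qfun s y - Qfun s x * Ptilde s y) / ((x : ℂ) - (y : ℂ))

/-- The limiting kernel `K_∞` (real-valued). -/
def Kinf (s : ℂ) (x y : ℝ) : ℝ := (KinfC s x y).re

/-- The generalized Cauchy weight `w_H` on `ℝ`. -/
def wH (s : ℂ) (N : ℕ) (x : ℝ) : ℝ :=
  (1 + x ^ 2) ^ (-s.re - (N : ℝ)) * Real.exp (2 * s.im * Complex.arg (1 + Complex.I * x))

/-- The polynomial `p_{N−1}`. -/
def pPrev (s : ℂ) (N : ℕ) (x : ℝ) : ℂ :=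
  ((x : ℂ) - Complex.I) ^ (N - 1) *
    twoF1neg (N - 1) (s + 1) ((2 * s.re + 2 : ℝ) : ℂ) (2 / (1 + Complex.I * (x : ℂ)))

/-- The polynomial `p̃_N`. -/
def pTil (s : ℂ) (N : ℕ) (x : ℝ) : ℂ :=
  ((x : ℂ) - Complex.I) ^ N *
    twoF1neg N s ((2 * s.re + 1 : ℝ) : ℂ) (2 / (1 + Complex.I * (x : ℂ)))

/-- The constant `C_{N,s}`. -/
def CNs (s : ℂ) (N : ℕ) : ℂ :=
  (((2 : ℝ) ^ (2 * s.re) / Real.pi : ℝ) : ℂ) *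
    (Complex.Gamma ((2 * s.re + N + 1 : ℝ) : ℂ) * Complex.Gamma (s + 1) *
        Complex.Gamma ((starRingEnd ℂ) s + 1) /
      (Complex.Gamma (N : ℂ) * Complex.Gamma ((2 * s.re + 1 : ℝ) : ℂ) *
        Complex.Gamma ((2 * s.re + 2 : ℝ) : ℂ)))

def phiN (s : ℂ) (N : ℕ) (x : ℝ) : ℂ := pTil s N x * (Real.sqrt (wH s N x) : ℂ)

def psiN (s : ℂ) (N : ℕ) (x : ℝ) : ℂ := pPrev s N x * (Real.sqrt (wH s N x) : ℂ)

/-- The finite-`N` kernel `K_N` (complex form; extended to the diagonal by continuity,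
i.e. by the Bernoulli–l'Hôpital expression). -/
def KNC (s : ℂ) (N : ℕ) (x y : ℝ) : ℂ :=
  if x = y then CNs s N * (deriv (phiN s N) x * psiN s N x - deriv (psiN s N) x * phiN s N x)
  else CNs s N * (phiN s N x * psiN s N y - psiN s N x * phiN s N y) / ((x : ℂ) - (y : ℂ))

/-- The finite-`N` kernel `K_N` (real-valued). -/
def KN (s : ℂ) (N : ℕ) (x y : ℝ) : ℝ := (KNC s N x y).re

/-- The rescaled kernel `K_[N](x,y) = N · K_N(Nx, Ny)`. -/
def Kscaled (s : ℂ) (N : ℕ) (x y : ℝ) : ℝ := N * KN s N (N * x) (N * y)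

/-- `P̃_N`. -/
def PtildeN (s : ℂ) (N : ℕ) (x : ℝ) : ℂ :=
  (((2 : ℝ) ^ s.re : ℝ) : ℂ) *
    (Real.sqrt (Real.Gamma (2 * s.re + N + 1) / (N * Real.Gamma N)) : ℂ) *
    pTil s N (N * x) * (Real.sqrt (wH s N (N * x)) : ℂ)

/-- `Q_N`. -/
def QN (s : ℂ) (N : ℕ) (x : ℝ) : ℂ :=
  (((2 : ℝ) ^ (s.re + 1) : ℝ) : ℂ) *
    (Real.sqrt (N * Real.Gamma (2 * s.re + N + 1) / Real.Gamma N) : ℂ) *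
    pPrev s N (N * x) * (Real.sqrt (wH s N (N * x)) : ℂ)

/-- `k`-point correlation function of a kernel. -/
def rhoK (K : ℝ → ℝ → ℝ) (k : ℕ) (x : Fin k → ℝ) : ℝ :=
  Matrix.det (Matrix.of fun i j => K (x i) (x j))

/-- The Fredholm determinant of a kernel restricted to `(t,∞)²`. -/
def fredholmDet (K : ℝ → ℝ → ℝ) (t : ℝ) : ℝ :=
  1 + ∑' k : ℕ, ((-1 : ℝ) ^ (k + 1) / (k + 1).factorial) *
    ∫ x : Fin (k + 1) → ℝ in Set.univ.pi fun _ => Set.Ioi t, rhoK K (k + 1) x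

/-- Mixed partial derivative `∂^{p+q}K/∂x^p∂y^q`. -/
def pderiv₂ (K : ℝ → ℝ → ℝ) (p q : ℕ) (x y : ℝ) : ℝ :=
  iteratedDeriv p (fun x' => iteratedDeriv q (fun y' => K x' y') y) x

/-- `F_{n,h,a}(x) = ₂F₁[−n, h, a; 2/(1+ix)]` (a terminating series). -/
def Fnha (n : ℕ) (h : ℂ) (a : ℝ) (x : ℝ) : ℂ :=
  ∑' k : ℕ, poch (-(n : ℂ)) k * poch h k / (poch (a : ℂ) k * (k.factorial : ℂ)) *
    (2 / (1 + Complex.I * (x : ℂ))) ^ k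

/-- `θ(τ) = τ (d/dτ) log F(τ⁻¹)`. -/
def thetaOf (F : ℝ → ℝ) (τ : ℝ) : ℝ := τ * deriv (fun u => Real.log (F u⁻¹)) τ

/-- Squared Vandermonde determinant `∏_{j<k} (x_j − x_k)²`. -/
def vandSq (N : ℕ) (x : Fin N → ℝ) : ℝ :=
  ∏ p ∈ Finset.univ.filter fun p : Fin N × Fin N => p.1 < p.2, (x p.1 - x p.2) ^ 2

/-- `φ(x,y) = (f(x)g(y) − g(x)f(y))/(x−y)`, extended to the diagonal. -/
def phiFG (f g : ℝ → ℝ) (x y : ℝ) : ℝ :=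
  if x = y then deriv f x * g x - deriv g x * f x else (f x * g y - g x * f y) / (x - y)

/-- Hadamard's inequality for a real matrix with entries bounded by `B`. -/
theorem abs_det_le_of_abs_le {n : ℕ} (M : Matrix (Fin n) (Fin n) ℝ) {B : ℝ}
    (hM : ∀ i j, |M i j| ≤ B) : |M.det| ≤ √((n : ℝ) ^ n) * B ^ n := by
  rcases Nat.eq_zero_or_pos n with rfl | hn
  · simp
  have hn' : (0 : ℝ) < n := by exact_mod_cast hn
  have hB : 0 ≤ B := (abs_nonneg _).trans (hM ⟨0, hn⟩ ⟨0, hn⟩)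
  have hP : (M.conjTranspose * M).PosSemidef := Matrix.posSemidef_conjTranspose_mul_self M
  have hdet : M.det ^ 2 = ∏ i, hP.isHermitian.eigenvalues i := by
    have := hP.isHermitian.det_eq_prod_eigenvalues
    simpa [Matrix.det_mul, sq] using this
  have htr : ∑ i, hP.isHermitian.eigenvalues i ≤ n * (n * B ^ 2) := by
    have h := hP.isHermitian.trace_eq_sum_eigenvalues
    simp only [RCLike.ofReal_real_eq_id, id_eq] at h
    rw [← h, Matrix.trace]
    have : ∀ i, (M.conjTranspose * M).diag i ≤ n * B ^ 2 := by
      intro i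
      rw [Matrix.diag_apply, Matrix.mul_apply]
      calc _ ≤ ∑ _j : Fin n, B ^ 2 := by
            refine Finset.sum_le_sum fun j _ => ?_
            rw [Matrix.conjTranspose_apply, star_trivial, ← sq, ← sq_abs]
            gcongr
            exact hM j i
        _ = _ := by simp
    calc _ ≤ ∑ _i : Fin n, (n * B ^ 2) := Finset.sum_le_sum fun i _ => this i
      _ = _ := by simp
  have hamgm := Real.geom_mean_le_arith_mean Finset.univ (fun _ : Fin n => (1 : ℝ))
    hP.isHermitian.eigenvalues (fun _ _ => zero_le_one) (by simpa using hn)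
    (fun i _ => hP.eigenvalues_nonneg i)
  simp only [Real.rpow_one, Finset.sum_const, Finset.card_univ, Fintype.card_fin, nsmul_eq_mul,
    mul_one, one_mul, ← hdet] at hamgm
  have hsq : M.det ^ 2 ≤ (n * B ^ 2) ^ n := by
    have h1 : (M.det ^ 2) ^ ((n : ℝ)⁻¹) ≤ n * B ^ 2 := by
      refine hamgm.trans ?_
      rw [div_le_iff₀ hn']
      linarith
    calc M.det ^ 2 = ((M.det ^ 2) ^ ((n : ℝ)⁻¹)) ^ n :=
          (Real.rpow_inv_natCast_pow (sq_nonneg _) hn.ne').symm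
      _ ≤ _ := by gcongr
  rw [← Real.sqrt_sq_eq_abs]
  calc √(M.det ^ 2) ≤ √((n * B ^ 2) ^ n) := Real.sqrt_le_sqrt hsq
    _ = √((n : ℝ) ^ n * (B ^ n) ^ 2) := by rw [mul_pow]; congr 2; ring
    _ = _ := by rw [Real.sqrt_mul (by positivity), Real.sqrt_sq (by positivity)]

theorem abs_det_le_of_abs_le_mul {n : ℕ} (A : Matrix (Fin n) (Fin n) ℝ) {B : ℝ} {w : Fin n → ℝ}
    (hw : ∀ i, 0 < w i) (hA : ∀ i j, |A i j| ≤ B * (w i * w j)) :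
    |A.det| ≤ √((n : ℝ) ^ n) * B ^ n * ∏ i, w i ^ 2 := by
  set M : Matrix (Fin n) (Fin n) ℝ := Matrix.of fun i j => A i j / (w i * w j) with hMdef
  have hM : ∀ i j, |M i j| ≤ B := by
    intro i j
    have := mul_pos (hw i) (hw j)
    rw [hMdef, Matrix.of_apply, abs_div, abs_of_pos this, div_le_iff₀ this]
    exact hA i j
  have hAM : A.det = (∏ i, w i) * ((∏ i, w i) * M.det) := by
    rw [← Matrix.det_mul_column, ← Matrix.det_mul_row]
    congr 1
    ext i j
    have hi := (hw i).ne'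
    have hj := (hw j).ne'
    simp only [hMdef, Matrix.of_apply]
    field_simp
  have hp : 0 ≤ ∏ i, w i := Finset.prod_nonneg fun i _ => (hw i).le
  rw [hAM, abs_mul, abs_mul, abs_of_nonneg hp, Finset.prod_pow]
  calc _ = |M.det| * (∏ i, w i) ^ 2 := by ring
    _ ≤ _ := by
      gcongr
      exact abs_det_le_of_abs_le M hM

theorem hasDerivAt_det {n : ℕ} {A : ℝ → Matrix (Fin n) (Fin n) ℝ} {A' : Matrix (Fin n) (Fin n) ℝ}
    {u : ℝ} (hA : ∀ i j, HasDerivAt (fun v => A v i j) (A' i j) u) :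
    HasDerivAt (fun v => (A v).det)
      (∑ i, ((A u).updateCol i fun r => A' r i).det) u := by
  simp only [Matrix.det_apply']
  rw [Finset.sum_comm]
  refine HasDerivAt.fun_sum fun σ _ => ?_
  rw [← Finset.mul_sum]
  refine HasDerivAt.const_mul _ ?_
  convert HasDerivAt.fun_finsetProd (u := Finset.univ) (fun i _ => hA (σ i) i) using 1
  refine Finset.sum_congr rfl fun i _ => ?_
  rw [← Finset.prod_erase_mul _ _ (Finset.mem_univ i), smul_eq_mul]
  congr 1
  · refine Finset.prod_congr rfl fun j hj => ?_
    rw [Matrix.updateCol_ne (Finset.ne_of_mem_erase hj)]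
  · simp

theorem abs_iteratedDeriv_det_le {n : ℕ} {A A' A'' : ℝ → Matrix (Fin n) (Fin n) ℝ}
    (hA : ∀ u, 0 < u → ∀ i j, HasDerivAt (fun v => A v i j) (A' u i j) u)
    (hA' : ∀ u, 0 < u → ∀ i j, HasDerivAt (fun v => A' v i j) (A'' u i j) u)
    {u B : ℝ} (hu : 0 < u) {w : Fin n → ℝ} (hw : ∀ i, 0 < w i)
    (h0 : ∀ i j, |A u i j| ≤ B * (w i * w j)) (h1 : ∀ i j, |A' u i j| ≤ B * (w i * w j))
    (h2 : ∀ i j, |A'' u i j| ≤ B * (w i * w j)) {p : ℕ} (hp : p ≤ 2) :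
    |iteratedDeriv p (fun v => (A v).det) u| ≤
      n ^ p * (√((n : ℝ) ^ n) * B ^ n * ∏ i, w i ^ 2) := by
  set H := √((n : ℝ) ^ n) * B ^ n * ∏ i, w i ^ 2 with hH
  have hd : ∀ v, 0 < v → deriv (fun v => (A v).det) v =
      ∑ i, ((A v).updateCol i fun r => A' v r i).det := fun v hv => (hasDerivAt_det (hA v hv)).deriv
  interval_cases p
  · simpa using abs_det_le_of_abs_le_mul _ hw h0
  · rw [iteratedDeriv_one, hd u hu]
    refine (Finset.abs_sum_le_sum_abs _ _).trans ?_
    calc _ ≤ ∑ _i : Fin n, H := by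
          refine Finset.sum_le_sum fun i _ => abs_det_le_of_abs_le_mul _ hw fun r c => ?_
          rw [Matrix.updateCol_apply]
          split_ifs with h
          · subst h; exact h1 _ _
          · exact h0 _ _
      _ = _ := by simp
  · have h' : ∀ i r c, HasDerivAt (fun v => ((A v).updateCol i fun r => A' v r i) r c)
        ((A' u).updateCol i (fun r => A'' u r i) r c) u := by
      intro i r c
      simp only [Matrix.updateCol_apply]
      split_ifs with h
      · exact hA' u hu r i
      · exact hA u hu r c
    have hdd : HasDerivAt (deriv fun v => (A v).det)
        (∑ i, ∑ j, (((A u).updateCol i fun r => A' u r i).updateCol j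
          fun r => (A' u).updateCol i (fun r => A'' u r i) r j).det) u := by
      refine (HasDerivAt.fun_sum fun i _ => hasDerivAt_det (h' i)).congr_of_eventuallyEq ?_
      filter_upwards [lt_mem_nhds hu] with v hv using hd v hv
    rw [iteratedDeriv_succ, iteratedDeriv_one, hdd.deriv]
    calc _ ≤ ∑ _i : Fin n, ∑ _j : Fin n, H := by
          refine (Finset.abs_sum_le_sum_abs _ _).trans (Finset.sum_le_sum fun i _ => ?_)
          refine (Finset.abs_sum_le_sum_abs _ _).trans (Finset.sum_le_sum fun j _ => ?_)
          refine abs_det_le_of_abs_le_mul _ hw fun r c => ?_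
          simp only [Matrix.updateCol_apply]
          split_ifs with h h3 h3
          · subst h h3; exact h2 _ _
          · subst h; exact h1 _ _
          · subst h3; exact h1 _ _
          · exact h0 _ _
      _ = _ := by simp; ring

theorem hasDerivAt_fst_of_differentiableAt {E : Type*} [NormedAddCommGroup E] [NormedSpace ℝ E]
    {f : ℝ × E → ℝ} {q : ℝ × E} (hf : DifferentiableAt ℝ f q) :
    HasDerivAt (fun u => f (u, q.2)) (fderiv ℝ f q (1, 0)) q.1 :=
  HasFDerivAt.comp_hasDerivAt (l := f) q.1 hf.hasFDerivAt
    ((hasDerivAt_id q.1).prodMk (hasDerivAt_const q.1 q.2))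

theorem hasDerivAt_snd_of_differentiableAt {E : Type*} [NormedAddCommGroup E] [NormedSpace ℝ E]
    {f : E × ℝ → ℝ} {q : E × ℝ} (hf : DifferentiableAt ℝ f q) :
    HasDerivAt (fun v => f (q.1, v)) (fderiv ℝ f q (0, 1)) q.2 :=
  HasFDerivAt.comp_hasDerivAt (l := f) q.2 hf.hasFDerivAt
    ((hasDerivAt_const q.2 q.1).prodMk (hasDerivAt_id q.2))

theorem hasDerivAt_diag_of_differentiableAt {f : ℝ × ℝ → ℝ} {u : ℝ}
    (hf : DifferentiableAt ℝ f (u, u)) :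
    HasDerivAt (fun v => f (v, v))
      (deriv (fun v => f (v, u)) u + deriv (fun v => f (u, v)) u) u := by
  rw [(hasDerivAt_fst_of_differentiableAt hf).deriv, (hasDerivAt_snd_of_differentiableAt hf).deriv,
    ← map_add]
  have := HasFDerivAt.comp_hasDerivAt (l := f) (f := fun v : ℝ => (v, v)) u hf.hasFDerivAt
    ((hasDerivAt_id u).prodMk (hasDerivAt_id u))
  rwa [Prod.mk_add_mk, add_zero, zero_add]

theorem contDiffOn_deriv_fst {E : Type*} [NormedAddCommGroup E] [NormedSpace ℝ E]
    {f : ℝ × E → ℝ} {Ω : Set (ℝ × E)} (hΩ : IsOpen Ω) {m n : WithTop ℕ∞} (hmn : n + 1 ≤ m)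
    (hf : ContDiffOn ℝ m f Ω) :
    ContDiffOn ℝ n (fun q => deriv (fun u => f (u, q.2)) q.1) Ω := by
  refine ((hf.fderiv_of_isOpen hΩ hmn).clm_apply
    (contDiffOn_const (c := ((1 : ℝ), (0 : E))))).congr fun q hq => ?_
  have hm : m ≠ 0 := by
    rintro rfl
    simp at hmn
  exact (hasDerivAt_fst_of_differentiableAt
    ((hf.differentiableOn hm).differentiableAt (hΩ.mem_nhds hq))).deriv

theorem contDiffOn_deriv_snd {E : Type*} [NormedAddCommGroup E] [NormedSpace ℝ E]
    {f : E × ℝ → ℝ} {Ω : Set (E × ℝ)} (hΩ : IsOpen Ω) {m n : WithTop ℕ∞} (hmn : n + 1 ≤ m)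
    (hf : ContDiffOn ℝ m f Ω) :
    ContDiffOn ℝ n (fun q => deriv (fun v => f (q.1, v)) q.2) Ω := by
  refine ((hf.fderiv_of_isOpen hΩ hmn).clm_apply
    (contDiffOn_const (c := ((0 : E), (1 : ℝ))))).congr fun q hq => ?_
  have hm : m ≠ 0 := by
    rintro rfl
    simp at hmn
  exact (hasDerivAt_snd_of_differentiableAt
    ((hf.differentiableOn hm).differentiableAt (hΩ.mem_nhds hq))).deriv

section Kernel

variable {K : ℝ → ℝ → ℝ}

theorem pderiv₂_one_zero (x y : ℝ) : pderiv₂ K 1 0 x y = deriv (fun x' => K x' y) x := by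
  simp [pderiv₂]

theorem pderiv₂_zero_one (x y : ℝ) : pderiv₂ K 0 1 x y = deriv (fun y' => K x y') y := by
  simp [pderiv₂]

theorem pderiv₂_two_zero (x y : ℝ) :
    pderiv₂ K 2 0 x y = deriv (fun x' => pderiv₂ K 1 0 x' y) x := by
  simp [pderiv₂, iteratedDeriv_succ]

theorem pderiv₂_zero_two (x y : ℝ) :
    pderiv₂ K 0 2 x y = deriv (fun y' => pderiv₂ K 0 1 x y') y := by
  simp [pderiv₂, iteratedDeriv_succ]

theorem pderiv₂_one_one (x y : ℝ) :
    pderiv₂ K 1 1 x y = deriv (fun x' => pderiv₂ K 0 1 x' y) x := by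
  simp [pderiv₂]

theorem isOpen_quadrant : IsOpen (Ioi (0 : ℝ) ×ˢ Ioi (0 : ℝ)) := isOpen_Ioi.prod isOpen_Ioi

theorem differentiableAt_kernel
    (hK : ContDiffOn ℝ 2 (Function.uncurry K) (Ioi 0 ×ˢ Ioi 0)) {x y : ℝ} (hx : 0 < x)
    (hy : 0 < y) : DifferentiableAt ℝ (Function.uncurry K) (x, y) :=
  (hK.differentiableOn (by norm_num)).differentiableAt (isOpen_quadrant.mem_nhds ⟨hx, hy⟩)

theorem differentiableAt_pderiv₂_one_zero
    (hK : ContDiffOn ℝ 2 (Function.uncurry K) (Ioi 0 ×ˢ Ioi 0)) {x y : ℝ} (hx : 0 < x)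
    (hy : 0 < y) : DifferentiableAt ℝ (Function.uncurry (pderiv₂ K 1 0)) (x, y) := by
  have h := contDiffOn_deriv_fst isOpen_quadrant (n := 1) (by norm_num [one_add_one_eq_two]) hK
  refine DifferentiableAt.congr_of_eventuallyEq ((h.differentiableOn one_ne_zero).differentiableAt
    (isOpen_quadrant.mem_nhds ⟨hx, hy⟩)) (Eventually.of_forall fun q => ?_)
  exact pderiv₂_one_zero q.1 q.2

theorem differentiableAt_pderiv₂_zero_one
    (hK : ContDiffOn ℝ 2 (Function.uncurry K) (Ioi 0 ×ˢ Ioi 0)) {x y : ℝ} (hx : 0 < x)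
    (hy : 0 < y) : DifferentiableAt ℝ (Function.uncurry (pderiv₂ K 0 1)) (x, y) := by
  have h := contDiffOn_deriv_snd isOpen_quadrant (n := 1) (by norm_num [one_add_one_eq_two]) hK
  refine DifferentiableAt.congr_of_eventuallyEq ((h.differentiableOn one_ne_zero).differentiableAt
    (isOpen_quadrant.mem_nhds ⟨hx, hy⟩)) (Eventually.of_forall fun q => ?_)
  exact pderiv₂_zero_one q.1 q.2

/-- The entrywise derivative in `u` of the matrix `(K (c i) (c j))` with `c = (u, x₁, …, x_k)`. -/
def consMatrixDeriv (K : ℝ → ℝ → ℝ) {k : ℕ} (x : Fin k → ℝ) (u : ℝ) :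
    Matrix (Fin (k + 1)) (Fin (k + 1)) ℝ :=
  Matrix.of (Fin.cons (Fin.cons (2 * pderiv₂ K 0 1 u u) fun j => pderiv₂ K 1 0 u (x j))
    fun i => Fin.cons (pderiv₂ K 0 1 (x i) u) fun _ => 0)

/-- The entrywise second derivative in `u` of the matrix `(K (c i) (c j))` with
`c = (u, x₁, …, x_k)`. -/
def consMatrixDeriv₂ (K : ℝ → ℝ → ℝ) {k : ℕ} (x : Fin k → ℝ) (u : ℝ) :
    Matrix (Fin (k + 1)) (Fin (k + 1)) ℝ :=
  Matrix.of (Fin.cons (Fin.cons (2 * (pderiv₂ K 1 1 u u + pderiv₂ K 0 2 u u))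
    fun j => pderiv₂ K 2 0 u (x j)) fun i => Fin.cons (pderiv₂ K 0 2 (x i) u) fun _ => 0)

theorem hasDerivAt_consMatrix
    (hK : ContDiffOn ℝ 2 (Function.uncurry K) (Ioi 0 ×ˢ Ioi 0))
    (hsymm : ∀ x y, 0 < x → 0 < y → K x y = K y x) {k : ℕ} {x : Fin k → ℝ} (hx : ∀ i, 0 < x i)
    {u : ℝ} (hu : 0 < u) (i j : Fin (k + 1)) :
    HasDerivAt (fun v => Matrix.of (fun i j => K ((Fin.cons v x : Fin (k + 1) → ℝ) i)
      ((Fin.cons v x : Fin (k + 1) → ℝ) j)) i j) (consMatrixDeriv K x u i j) u := by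
  induction i using Fin.cases with
  | zero =>
    induction j using Fin.cases with
    | zero =>
      simp only [Matrix.of_apply, consMatrixDeriv, Fin.cons_zero]
      have h := hasDerivAt_diag_of_differentiableAt (differentiableAt_kernel hK hu hu)
      simp only [Function.uncurry_apply_pair] at h
      have he : (fun v => K v u) =ᶠ[nhds u] fun v => K u v := by
        filter_upwards [lt_mem_nhds hu] with v hv using hsymm v u hv hu
      rw [he.deriv_eq, ← two_mul] at h
      rwa [pderiv₂_zero_one]
    | succ j =>
      simp only [Matrix.of_apply, consMatrixDeriv, Fin.cons_zero, Fin.cons_succ]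
      rw [pderiv₂_one_zero]
      exact (hasDerivAt_fst_of_differentiableAt
        (differentiableAt_kernel hK hu (hx j))).differentiableAt.hasDerivAt
  | succ i =>
    induction j using Fin.cases with
    | zero =>
      simp only [Matrix.of_apply, consMatrixDeriv, Fin.cons_zero, Fin.cons_succ]
      rw [pderiv₂_zero_one]
      exact (hasDerivAt_snd_of_differentiableAt
        (differentiableAt_kernel hK (hx i) hu)).differentiableAt.hasDerivAt
    | succ j =>
      simp only [Matrix.of_apply, consMatrixDeriv, Fin.cons_succ]
      exact hasDerivAt_const _ _

theorem hasDerivAt_consMatrixDeriv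
    (hK : ContDiffOn ℝ 2 (Function.uncurry K) (Ioi 0 ×ˢ Ioi 0))
    {k : ℕ} {x : Fin k → ℝ} (hx : ∀ i, 0 < x i)
    {u : ℝ} (hu : 0 < u) (i j : Fin (k + 1)) :
    HasDerivAt (fun v => consMatrixDeriv K x v i j) (consMatrixDeriv₂ K x u i j) u := by
  induction i using Fin.cases with
  | zero =>
    induction j using Fin.cases with
    | zero =>
      simp only [Matrix.of_apply, consMatrixDeriv, consMatrixDeriv₂, Fin.cons_zero]
      rw [pderiv₂_one_one, pderiv₂_zero_two]
      exact (hasDerivAt_diag_of_differentiableAt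
        (differentiableAt_pderiv₂_zero_one hK hu hu)).const_mul 2
    | succ j =>
      simp only [Matrix.of_apply, consMatrixDeriv, consMatrixDeriv₂, Fin.cons_zero, Fin.cons_succ]
      rw [pderiv₂_two_zero]
      exact (hasDerivAt_fst_of_differentiableAt
        (differentiableAt_pderiv₂_one_zero hK hu (hx j))).differentiableAt.hasDerivAt
  | succ i =>
    induction j using Fin.cases with
    | zero =>
      simp only [Matrix.of_apply, consMatrixDeriv, consMatrixDeriv₂, Fin.cons_zero, Fin.cons_succ]
      rw [pderiv₂_zero_two]
      exact (hasDerivAt_snd_of_differentiableAt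
        (differentiableAt_pderiv₂_zero_one hK (hx i) hu)).differentiableAt.hasDerivAt
    | succ j =>
      simp only [Matrix.of_apply, consMatrixDeriv, consMatrixDeriv₂, Fin.cons_succ]
      exact hasDerivAt_const _ _

/-- The `p`-th partial derivative of `ρ_{k+1}(u, x₁, …, x_k)` in `u`. -/
def rhoD (K : ℝ → ℝ → ℝ) (k p : ℕ) (u : ℝ) (x : Fin k → ℝ) : ℝ :=
  iteratedDeriv p (fun v => rhoK K (k + 1) (Fin.cons v x)) u

theorem abs_rhoD_le
    (hK : ContDiffOn ℝ 2 (Function.uncurry K) (Ioi 0 ×ˢ Ioi 0))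
    (hsymm : ∀ x y, 0 < x → 0 < y → K x y = K y x) {α x₀ C : ℝ} (hx₀ : 0 < x₀)
    (hC : ∀ p q : ℕ, p + q ≤ 2 →
      ∀ x y : ℝ, x₀ ≤ x → x₀ ≤ y → |pderiv₂ K p q x y| ≤ C / (x * y) ^ α)
    {k p : ℕ} (hp : p ≤ 2) {u : ℝ} (hu : x₀ ≤ u) {x : Fin k → ℝ} (hx : ∀ i, x₀ ≤ x i) :
    |rhoD K k p u x| ≤ (k + 1) ^ 2 * (√(((k : ℝ) + 1) ^ (k + 1)) * (4 * C) ^ (k + 1)) *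
      (u ^ (-(2 * α)) * ∏ i, x i ^ (-(2 * α))) := by
  have hu0 : 0 < u := hx₀.trans_le hu
  have hx0 : ∀ i, 0 < x i := fun i => hx₀.trans_le (hx i)
  set c : Fin (k + 1) → ℝ := Fin.cons u x with hc
  have hcpos : ∀ i, 0 < c i := fun i => by
    induction i using Fin.cases with
    | zero => exact hu0
    | succ i => exact hx0 i
  have hcle : ∀ i, x₀ ≤ c i := fun i => by
    induction i using Fin.cases with
    | zero => exact hu
    | succ i => exact hx i
  have hC0 : 0 ≤ C := by
    have h := (abs_nonneg _).trans (hC 0 0 (by norm_num) x₀ x₀ le_rfl le_rfl)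
    have h2 : 0 < (x₀ * x₀) ^ α := by positivity
    have h3 := mul_nonneg h h2.le
    rwa [div_mul_cancel₀ _ h2.ne'] at h3
  set w : Fin (k + 1) → ℝ := fun i => c i ^ (-α) with hw
  have hwpos : ∀ i, 0 < w i := fun i => Real.rpow_pos_of_pos (hcpos i) _
  have key : ∀ p q : ℕ, p + q ≤ 2 → ∀ i j, |pderiv₂ K p q (c i) (c j)| ≤ C * (w i * w j) := by
    intro p q hpq i j
    refine (hC p q hpq _ _ (hcle i) (hcle j)).trans (le_of_eq ?_)
    simp only [hw]
    rw [← Real.mul_rpow (hcpos i).le (hcpos j).le,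
      Real.rpow_neg (mul_pos (hcpos i) (hcpos j)).le, div_eq_mul_inv]
  have hww : ∀ i j, 0 ≤ C * (w i * w j) := fun i j =>
    mul_nonneg hC0 (mul_pos (hwpos i) (hwpos j)).le
  have h0 : ∀ i j, |Matrix.of (fun i j => K (c i) (c j)) i j| ≤ 4 * C * (w i * w j) := by
    intro i j
    have := key 0 0 (by norm_num) i j
    simp only [pderiv₂, iteratedDeriv_zero] at this
    rw [Matrix.of_apply]
    linarith [hww i j]
  have h1 : ∀ i j, |consMatrixDeriv K x u i j| ≤ 4 * C * (w i * w j) := by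
    intro i j
    have h := hww i j
    have ka := key 0 1 (by norm_num) i j
    have kb := key 1 0 (by norm_num) i j
    revert h ka kb
    induction i using Fin.cases with
    | zero =>
      induction j using Fin.cases with
      | zero =>
        simp only [Matrix.of_apply, consMatrixDeriv, Fin.cons_zero, hc, abs_mul, abs_two]
        intros; linarith
      | succ j =>
        simp only [Matrix.of_apply, consMatrixDeriv, Fin.cons_zero, hc, Fin.cons_succ]
        intros; linarith
    | succ i =>
      induction j using Fin.cases with
      | zero =>
        simp only [Matrix.of_apply, consMatrixDeriv, Fin.cons_zero, hc, Fin.cons_succ]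
        intros; linarith
      | succ j =>
        simp only [Matrix.of_apply, consMatrixDeriv, Fin.cons_succ, abs_zero]
        intros; linarith
  have h2 : ∀ i j, |consMatrixDeriv₂ K x u i j| ≤ 4 * C * (w i * w j) := by
    intro i j
    have h := hww i j
    have ka := key 1 1 (by norm_num) i j
    have kb := key 0 2 (by norm_num) i j
    have kc := key 2 0 (by norm_num) i j
    revert h ka kb kc
    induction i using Fin.cases with
    | zero =>
      induction j using Fin.cases with
      | zero =>
        simp only [Matrix.of_apply, consMatrixDeriv₂, Fin.cons_zero, hc, abs_mul, abs_two]
        intros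
        linarith [abs_add_le (pderiv₂ K 1 1 u u) (pderiv₂ K 0 2 u u)]
      | succ j =>
        simp only [Matrix.of_apply, consMatrixDeriv₂, Fin.cons_zero, hc, Fin.cons_succ]
        intros; linarith
    | succ i =>
      induction j using Fin.cases with
      | zero =>
        simp only [Matrix.of_apply, consMatrixDeriv₂, Fin.cons_zero, hc, Fin.cons_succ]
        intros; linarith
      | succ j =>
        simp only [Matrix.of_apply, consMatrixDeriv₂, Fin.cons_succ, abs_zero]
        intros; linarith
  have main := abs_iteratedDeriv_det_le
    (A := fun v => Matrix.of (fun i j => K ((Fin.cons v x : Fin (k + 1) → ℝ) i)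
      ((Fin.cons v x : Fin (k + 1) → ℝ) j)))
    (fun v hv => hasDerivAt_consMatrix hK hsymm hx0 hv)
    (fun v hv => hasDerivAt_consMatrixDeriv hK hx0 hv) hu0 hwpos h0 h1 h2 hp
  have hprod : ∏ i, w i ^ 2 = u ^ (-(2 * α)) * ∏ i, x i ^ (-(2 * α)) := by
    have hsq : ∀ i, w i ^ 2 = c i ^ (-(2 * α)) := fun i => by
      rw [hw, ← Real.rpow_natCast, ← Real.rpow_mul (hcpos i).le]
      congr 1
      push_cast
      ring
    simp only [hsq, Fin.prod_univ_succ, hc, Fin.cons_zero, Fin.cons_succ]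
  rw [hprod] at main
  have hP : 0 ≤ u ^ (-(2 * α)) * ∏ i, x i ^ (-(2 * α)) := by
    rw [← hprod]
    positivity
  refine main.trans ?_
  push_cast
  rw [← mul_assoc _ (√(((k : ℝ) + 1) ^ (k + 1)) * (4 * C) ^ (k + 1))]
  have h1k : (1 : ℝ) ≤ k + 1 := by linarith [(Nat.cast_nonneg k : (0 : ℝ) ≤ k)]
  gcongr

theorem isOpen_orthant (k : ℕ) :
    IsOpen (Ioi (0 : ℝ) ×ˢ (univ.pi fun _ : Fin k => Ioi (0 : ℝ))) :=
  isOpen_Ioi.prod (isOpen_set_pi finite_univ fun _ _ => isOpen_Ioi)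

theorem contDiffOn_rhoK (hK : ContDiffOn ℝ 2 (Function.uncurry K) (Ioi 0 ×ˢ Ioi 0)) (k : ℕ) :
    ContDiffOn ℝ 2 (rhoK K k) (univ.pi fun _ => Ioi 0) := by
  unfold rhoK
  simp only [Matrix.det_apply', Matrix.of_apply]
  refine ContDiffOn.sum fun σ _ => contDiffOn_const.mul (contDiffOn_prod fun i _ => ?_)
  refine ContDiffOn.comp (g := Function.uncurry K) (f := fun x : Fin k → ℝ => (x (σ i), x i)) hK
    (by fun_prop) ?_
  intro x hx
  exact ⟨hx _ (mem_univ _), hx _ (mem_univ _)⟩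

theorem contDiffOn_rhoK_cons (hK : ContDiffOn ℝ 2 (Function.uncurry K) (Ioi 0 ×ˢ Ioi 0)) (k : ℕ) :
    ContDiffOn ℝ 2 (fun q : ℝ × (Fin k → ℝ) => rhoK K (k + 1) (Fin.cons q.1 q.2))
      (Ioi 0 ×ˢ univ.pi fun _ => Ioi 0) := by
  refine (contDiffOn_rhoK hK (k + 1)).comp (ContDiff.contDiffOn ?_) ?_
  · rw [contDiff_pi]
    intro i
    induction i using Fin.cases with
    | zero => simpa using contDiff_fst
    | succ i =>
      simp only [Fin.cons_succ]
      fun_prop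
  · rintro ⟨u, x⟩ ⟨hu, hx⟩ i -
    induction i using Fin.cases with
    | zero => exact hu
    | succ i => exact hx i (mem_univ i)

theorem rhoD_zero (k : ℕ) (u : ℝ) (x : Fin k → ℝ) :
    rhoD K k 0 u x = rhoK K (k + 1) (Fin.cons u x) := by
  simp [rhoD]

theorem rhoD_succ (k p : ℕ) (u : ℝ) (x : Fin k → ℝ) :
    rhoD K k (p + 1) u x = deriv (fun v => rhoD K k p v x) u := by
  simp [rhoD, iteratedDeriv_succ]

theorem contDiffOn_rhoD (hK : ContDiffOn ℝ 2 (Function.uncurry K) (Ioi 0 ×ˢ Ioi 0)) {k p n : ℕ}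
    (hp : n + p ≤ 2) :
    ContDiffOn ℝ n (fun q : ℝ × (Fin k → ℝ) => rhoD K k p q.1 q.2)
      (Ioi 0 ×ˢ univ.pi fun _ => Ioi 0) := by
  induction p generalizing n with
  | zero =>
    simp only [rhoD_zero]
    exact (contDiffOn_rhoK_cons hK k).of_le (by exact_mod_cast hp)
  | succ p ih =>
    simp only [rhoD_succ]
    exact contDiffOn_deriv_fst (isOpen_orthant k) (m := (n + 1 : ℕ)) (by simp)
      (ih (n := n + 1) (by omega))

theorem hasDerivAt_rhoD (hK : ContDiffOn ℝ 2 (Function.uncurry K) (Ioi 0 ×ˢ Ioi 0)) {k p : ℕ}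
    (hp : p ≤ 1) {u : ℝ} (hu : 0 < u) {x : Fin k → ℝ} (hx : ∀ i, 0 < x i) :
    HasDerivAt (fun v => rhoD K k p v x) (rhoD K k (p + 1) u x) u := by
  rw [rhoD_succ]
  have h := (contDiffOn_rhoD hK (k := k) (p := p) (n := 1) (by omega)).differentiableOn
    (by simp)
  exact (hasDerivAt_fst_of_differentiableAt (h.differentiableAt
    ((isOpen_orthant k).mem_nhds (show (u, x) ∈ _ from ⟨hu, fun i _ => hx i⟩))))
      |>.differentiableAt.hasDerivAt

theorem rhoK_eq_zero_of_eq {k : ℕ} {x : Fin k → ℝ} {i j : Fin k} (hij : i ≠ j)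
    (h : x i = x j) : rhoK K k x = 0 :=
  Matrix.det_zero_of_row_eq hij (by ext; simp [h])

theorem rhoK_comp_perm {k : ℕ} (x : Fin k → ℝ) (σ : Equiv.Perm (Fin k)) :
    rhoK K k (x ∘ σ) = rhoK K k x :=
  Matrix.det_submatrix_equiv_self σ (Matrix.of fun i j => K (x i) (x j))

theorem rhoD_eq_zero (hpos : ∀ (k : ℕ) (x : Fin k → ℝ), (∀ i, 0 < x i) →
      (Matrix.of fun i j => K (x i) (x j)).PosSemidef) {k p : ℕ} (hp : p ≤ 1) {u : ℝ} (hu : 0 < u)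
    {x : Fin k → ℝ} (hx : ∀ i, 0 < x i) {i : Fin k} (hi : x i = u) : rhoD K k p u x = 0 := by
  have h0 : rhoD K k 0 u x = 0 := by
    rw [rhoD_zero]
    exact rhoK_eq_zero_of_eq (i := 0) (j := i.succ) (Fin.succ_ne_zero i).symm (by simp [hi])
  interval_cases p
  · exact h0
  · rw [rhoD_succ]
    refine IsLocalMin.deriv_eq_zero ?_
    filter_upwards [lt_mem_nhds hu] with v hv
    rw [h0, rhoD_zero]
    refine (hpos (k + 1) _ fun i => ?_).det_nonneg
    induction i using Fin.cases with
    | zero => exact hv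
    | succ i => exact hx i

end Kernel

/-- The orthant `(t, ∞)^k`. -/
abbrev orthant (k : ℕ) (t : ℝ) : Set (Fin k → ℝ) := univ.pi fun _ => Ioi t

/-- The pairs `(u, x)` with `t < u` and `u < x i` for all `i`. -/
def minRegion (k : ℕ) (t : ℝ) : Set (ℝ × (Fin k → ℝ)) := {q | t < q.1 ∧ ∀ i, q.1 < q.2 i}

theorem isOpen_minRegion (k : ℕ) (t : ℝ) : IsOpen (minRegion k t) := by
  simp only [minRegion, ofPred_and, ofPred_forall]
  refine (isOpen_lt continuous_const continuous_fst).inter (isOpen_iInter_of_finite fun i => ?_)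
  exact isOpen_lt continuous_fst (by fun_prop)

theorem measurableSet_orthant (k : ℕ) (t : ℝ) : MeasurableSet (orthant k t) :=
  MeasurableSet.univ_pi fun _ => measurableSet_Ioi

theorem minRegion_subset (k : ℕ) (t : ℝ) : minRegion k t ⊆ Ioi t ×ˢ orthant k t :=
  fun _ hq => ⟨hq.1, fun i _ => hq.1.trans (hq.2 i)⟩

theorem integrableOn_prod_rpow {β t : ℝ} (hβ : 1 < β) (ht : 0 < t) (k : ℕ) :
    IntegrableOn (fun x : Fin k → ℝ => ∏ i, x i ^ (-β)) (orthant k t) := by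
  rw [IntegrableOn, volume_pi, Measure.restrict_pi_pi]
  exact Integrable.fintype_prod fun _ => integrableOn_Ioi_rpow_of_lt (by linarith) ht

theorem setIntegral_prod_rpow (β t : ℝ) (k : ℕ) :
    ∫ x : Fin k → ℝ in orthant k t, ∏ i, x i ^ (-β) = (∫ v in Ioi t, v ^ (-β)) ^ k := by
  rw [volume_pi, Measure.restrict_pi_pi, integral_fintype_prod_eq_pow (fun v : ℝ => v ^ (-β)),
    Fintype.card_fin]

/-- On `[t, ∞)^{1+k}`, `g` is bounded by a multiple of the product of `y ^ (-β)` over all its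
variables `y`. -/
def RpowBounded {k : ℕ} (g : ℝ → (Fin k → ℝ) → ℝ) (β t A : ℝ) : Prop :=
  ∀ u, t ≤ u → ∀ x : Fin k → ℝ, (∀ i, t ≤ x i) → |g u x| ≤ A * (u ^ (-β) * ∏ i, x i ^ (-β))

section Fubini

variable {k : ℕ} {g : ℝ → (Fin k → ℝ) → ℝ} {β : ℝ}

theorem continuousOn_section
    (hg : ContinuousOn (fun q : ℝ × (Fin k → ℝ) => g q.1 q.2) (Ioi 0 ×ˢ orthant k 0))
    {u : ℝ} (hu : 0 < u) : ContinuousOn (g u) (orthant k 0) :=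
  hg.comp (f := fun x => (u, x)) (by fun_prop) fun _ hx => ⟨hu, hx⟩

theorem orthant_subset {s t : ℝ} (h : s ≤ t) : orthant k t ⊆ orthant k s :=
  pi_mono fun _ _ => Ioi_subset_Ioi h

theorem integrableOn_section (hβ : 1 < β)
    (hg : ContinuousOn (fun q : ℝ × (Fin k → ℝ) => g q.1 q.2) (Ioi 0 ×ˢ orthant k 0))
    {t A : ℝ} (ht : 0 < t) (hb : RpowBounded g β t A) {u : ℝ} (hu : t ≤ u) :
    IntegrableOn (g u) (orthant k t) := by
  refine Integrable.mono' (((integrableOn_prod_rpow hβ ht k).const_mul (u ^ (-β))).const_mul A)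
    (((continuousOn_section hg (ht.trans_le hu)).mono
      (orthant_subset ht.le)).aestronglyMeasurable (measurableSet_orthant k t)) ?_
  filter_upwards [ae_restrict_mem (measurableSet_orthant k t)] with x hx
  exact hb u hu x fun i => (hx i (mem_univ i)).le

theorem setIntegral_abs_section_le (hβ : 1 < β)
    (hg : ContinuousOn (fun q : ℝ × (Fin k → ℝ) => g q.1 q.2) (Ioi 0 ×ˢ orthant k 0))
    {t A : ℝ} (ht : 0 < t) (hA : 0 ≤ A) (hb : RpowBounded g β t A) {u : ℝ} (hu : t ≤ u) :
    ∫ x in orthant k u, |g u x| ≤ A * (t ^ (-β) * (∫ v in Ioi t, v ^ (-β)) ^ k) := by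
  have hu0 : 0 < u := ht.trans_le hu
  calc ∫ x in orthant k u, |g u x| ≤ ∫ x in orthant k t, |g u x| := by
        refine setIntegral_mono_set (integrableOn_section hβ hg ht hb hu).abs
          (Eventually.of_forall fun x => abs_nonneg _) (orthant_subset hu).eventuallyLE
    _ ≤ ∫ x in orthant k t, A * (t ^ (-β) * ∏ i, x i ^ (-β)) := by
        refine setIntegral_mono_on (integrableOn_section hβ hg ht hb hu).abs
          (((integrableOn_prod_rpow hβ ht k).const_mul (t ^ (-β))).const_mul A)
          (measurableSet_orthant k t) fun x hx => ?_
        refine (hb u hu x fun i => (hx i (mem_univ i)).le).trans ?_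
        have : 0 ≤ ∏ i, x i ^ (-β) := Finset.prod_nonneg fun i _ =>
          Real.rpow_nonneg (ht.trans (hx i (mem_univ i))).le _
        have h2 : u ^ (-β) ≤ t ^ (-β) := Real.rpow_le_rpow_of_nonpos ht hu (by linarith)
        gcongr
    _ = _ := by
        rw [integral_const_mul, integral_const_mul, setIntegral_prod_rpow]

theorem continuousAt_setIntegral_orthant (hβ : 1 < β)
    (hg : ContinuousOn (fun q : ℝ × (Fin k → ℝ) => g q.1 q.2) (Ioi 0 ×ˢ orthant k 0))
    (hb : ∀ t, 0 < t → ∃ A, RpowBounded g β t A) {t : ℝ} (ht : 0 < t) :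
    ContinuousAt (fun u => ∫ x in orthant k u, g u x) t := by
  have ht2 : 0 < t / 2 := by linarith
  obtain ⟨A, hA⟩ := hb (t / 2) ht2
  simp only [← integral_indicator (measurableSet_orthant k _)]
  have hnear : ∀ᶠ s in nhds t, t / 2 < s := lt_mem_nhds (by linarith)
  refine continuousAt_of_dominated (bound := (orthant k (t / 2)).indicator fun x =>
    |A| * ((t / 2) ^ (-β) * ∏ i, x i ^ (-β))) ?_ ?_ ?_ ?_
  · filter_upwards [hnear] with s hs
    rw [aestronglyMeasurable_indicator_iff (measurableSet_orthant k s)]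
    exact ((integrableOn_section hβ hg ht2 hA hs.le).mono_set
      (orthant_subset hs.le)).aestronglyMeasurable
  · filter_upwards [hnear] with s hs
    refine Eventually.of_forall fun x => ?_
    by_cases hx : x ∈ orthant k s
    · have hx2 := orthant_subset hs.le hx
      rw [indicator_of_mem hx, indicator_of_mem hx2]
      refine (hA s hs.le x fun i => (hx2 i (mem_univ i)).le).trans ?_
      have hp : 0 ≤ ∏ i, x i ^ (-β) := Finset.prod_nonneg fun i _ =>
        Real.rpow_nonneg (ht2.trans (hx2 i (mem_univ i))).le _
      have h2 : s ^ (-β) ≤ (t / 2) ^ (-β) := Real.rpow_le_rpow_of_nonpos ht2 hs.le (by linarith)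
      have h3 : 0 ≤ s ^ (-β) := Real.rpow_nonneg (ht2.trans hs).le _
      have h4 := le_abs_self A
      gcongr
    · rw [indicator_of_notMem hx, norm_zero]
      refine indicator_nonneg (fun y hy => ?_) x
      have hp : 0 ≤ ∏ i, y i ^ (-β) := Finset.prod_nonneg fun i _ =>
        Real.rpow_nonneg (ht2.trans (hy i (mem_univ i))).le _
      positivity
  · rw [integrable_indicator_iff (measurableSet_orthant k _)]
    exact ((integrableOn_prod_rpow hβ ht2 k).const_mul _).const_mul _
  · have hne : ∀ᵐ x : Fin k → ℝ, ∀ i, x i ≠ t :=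
      ae_all_iff.2 fun i => Measure.ae_eval_ne (μ := fun _ : Fin k => (volume : Measure ℝ)) i t
    filter_upwards [hne] with x hx
    by_cases hxt : ∀ i, t < x i
    · have h1 : ∀ᶠ s in nhds t, ∀ i, s < x i := eventually_all.2 fun i => gt_mem_nhds (hxt i)
      have hc : ContinuousAt (fun s => g s x) t := by
        refine ContinuousAt.comp (g := fun q : ℝ × (Fin k → ℝ) => g q.1 q.2)
          (f := fun s => (s, x)) (hg.continuousAt ?_) (by fun_prop)
        exact (isOpen_Ioi.prod (isOpen_set_pi finite_univ fun _ _ => isOpen_Ioi)).mem_nhds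
          ⟨ht, fun i _ => ht.trans (hxt i)⟩
      refine hc.congr ?_
      filter_upwards [h1] with s hs
      rw [indicator_of_mem (show x ∈ orthant k s from fun i _ => hs i)]
    · push Not at hxt
      obtain ⟨i, hi⟩ := hxt
      have hlt : x i < t := lt_of_le_of_ne hi (hx i)
      refine continuousAt_const.congr (f := fun _ => (0 : ℝ)) ?_
      filter_upwards [lt_mem_nhds hlt] with s hs
      rw [indicator_of_notMem fun h => ?_]
      exact absurd (h i (mem_univ i)) (not_lt.2 hs.le)

theorem integrableOn_minRegion (hβ : 1 < β)
    (hg : ContinuousOn (fun q : ℝ × (Fin k → ℝ) => g q.1 q.2) (Ioi 0 ×ˢ orthant k 0))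
    {t A : ℝ} (ht : 0 < t) (hb : RpowBounded g β t A) :
    IntegrableOn (fun q : ℝ × (Fin k → ℝ) => g q.1 q.2) (minRegion k t) := by
  have hms : MeasurableSet (Ioi t ×ˢ orthant k t) :=
    measurableSet_Ioi.prod (measurableSet_orthant k t)
  refine IntegrableOn.mono_set ?_ (minRegion_subset k t)
  have hd : IntegrableOn (fun q : ℝ × (Fin k → ℝ) => q.1 ^ (-β) * ∏ i, q.2 i ^ (-β))
      (Ioi t ×ˢ orthant k t) := by
    rw [IntegrableOn, Measure.volume_eq_prod, ← Measure.prod_restrict]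
    exact Integrable.mul_prod (integrableOn_Ioi_rpow_of_lt (a := -β) (by linarith) ht)
      (integrableOn_prod_rpow hβ ht k)
  refine Integrable.mono' (hd.const_mul A) ((hg.mono (prod_mono (Ioi_subset_Ioi ht.le)
    (orthant_subset ht.le))).aestronglyMeasurable hms) ?_
  filter_upwards [ae_restrict_mem hms] with q hq
  exact hb q.1 (le_of_lt hq.1) q.2 fun i => (hq.2 i (mem_univ i)).le

theorem indicator_minRegion_left (t u : ℝ) :
    ∫ x, (minRegion k t).indicator (fun q => g q.1 q.2) (u, x) =
      (Ioi t).indicator (fun u => ∫ x in orthant k u, g u x) u := by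
  by_cases hu : t < u
  · rw [indicator_of_mem (show u ∈ Ioi t from hu), ← integral_indicator (measurableSet_orthant k u)]
    refine integral_congr_ae (Eventually.of_forall fun x => ?_)
    simp only [indicator, minRegion, mem_ofPred_eq, hu, true_and, mem_univ_pi, mem_Ioi]
  · rw [indicator_of_notMem (show u ∉ Ioi t from hu)]
    simp [indicator, minRegion, hu]

theorem setIntegral_minRegion (hβ : 1 < β)
    (hg : ContinuousOn (fun q : ℝ × (Fin k → ℝ) => g q.1 q.2) (Ioi 0 ×ˢ orthant k 0))
    {t A : ℝ} (ht : 0 < t) (hb : RpowBounded g β t A) :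
    IntegrableOn (fun u => ∫ x in orthant k u, g u x) (Ioi t) ∧
    ∫ q in minRegion k t, g q.1 q.2 = ∫ u in Ioi t, ∫ x in orthant k u, g u x := by
  have hm := (isOpen_minRegion k t).measurableSet
  have hint := (integrable_indicator_iff hm).2 (integrableOn_minRegion hβ hg ht hb)
  rw [Measure.volume_eq_prod] at hint
  constructor
  · rw [← integrable_indicator_iff measurableSet_Ioi]
    refine hint.integral_prod_left.congr (Eventually.of_forall fun u => ?_)
    exact indicator_minRegion_left t u
  · rw [← integral_indicator hm, ← integral_indicator measurableSet_Ioi, Measure.volume_eq_prod,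
      integral_prod _ hint]
    exact integral_congr_ae (Eventually.of_forall fun u => indicator_minRegion_left t u)

theorem setIntegral_minRegion_deriv {k : ℕ} {g g' : ℝ → (Fin (k + 1) → ℝ) → ℝ} (hβ : 1 < β)
    (hg' : ContinuousOn (fun q : ℝ × (Fin (k + 1) → ℝ) => g' q.1 q.2)
      (Ioi 0 ×ˢ orthant (k + 1) 0))
    (hd : ∀ u, 0 < u → ∀ x ∈ orthant (k + 1) 0, HasDerivAt (fun v => g v x) (g' u x) u)
    (h0 : ∀ u, 0 < u → ∀ x ∈ orthant (k + 1) 0, ∀ i, x i = u → g u x = 0)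
    {t A : ℝ} (ht : 0 < t) (hb : RpowBounded g' β t A) :
    ∫ q in minRegion (k + 1) t, g' q.1 q.2 = -∫ x in orthant (k + 1) t, g t x := by
  have hm := (isOpen_minRegion (k + 1) t).measurableSet
  have hint := (integrable_indicator_iff hm).2 (integrableOn_minRegion hβ hg' ht hb)
  rw [Measure.volume_eq_prod] at hint
  rw [← integral_neg, ← integral_indicator hm, ← integral_indicator (measurableSet_orthant _ t),
    Measure.volume_eq_prod, integral_prod_symm _ hint]
  refine integral_congr_ae (Eventually.of_forall fun x => ?_)
  simp only
  by_cases hx : x ∈ orthant (k + 1) t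
  · rw [indicator_of_mem hx]
    have hx0 := orthant_subset ht.le hx
    obtain ⟨m, hmin⟩ := Finite.exists_min x
    have htm : t < x m := hx m (mem_univ m)
    have hset : ∀ u, (minRegion (k + 1) t).indicator (fun q => g' q.1 q.2) (u, x) =
        (Ioo t (x m)).indicator (fun u => g' u x) u := by
      intro u
      have : (u, x) ∈ minRegion (k + 1) t ↔ u ∈ Ioo t (x m) :=
        ⟨fun h => ⟨h.1, h.2 m⟩, fun h => ⟨h.1, fun i => h.2.trans_le (hmin i)⟩⟩
      simp only [indicator, this]
    simp only [hset]
    rw [integral_indicator measurableSet_Ioo, ← integral_Ioc_eq_integral_Ioo,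
      ← intervalIntegral.integral_of_le htm.le,
      intervalIntegral.integral_eq_sub_of_hasDerivAt (f := fun v => g v x), h0 (x m)
        (ht.trans htm) x hx0 m rfl, zero_sub]
    · intro u hu
      rw [uIcc_of_le htm.le] at hu
      exact hd u (ht.trans_le hu.1) x hx0
    · refine ContinuousOn.intervalIntegrable ?_
      rw [uIcc_of_le htm.le]
      exact hg'.comp (f := fun u => (u, x)) (by fun_prop) fun u hu => ⟨ht.trans_le hu.1, hx0⟩
  · rw [indicator_of_notMem hx]
    have hset : ∀ u, (minRegion (k + 1) t).indicator (fun q => g' q.1 q.2) (u, x) = 0 := by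
      intro u
      refine indicator_of_notMem (fun h => hx fun i _ => ?_) _
      exact h.1.trans (h.2 i)
    simp [hset]

theorem hasDerivAt_integral_Ioi {h : ℝ → ℝ} (hc : ContinuousOn h (Ioi 0))
    (hi : ∀ t, 0 < t → IntegrableOn h (Ioi t)) {t : ℝ} (ht : 0 < t) :
    HasDerivAt (fun s => ∫ u in Ioi s, h u) (-h t) t := by
  have ht2 : 0 < t / 2 := by linarith
  have hI : HasDerivAt (fun s => ∫ u in (t / 2)..s, h u) (h t) t := by
    refine intervalIntegral.integral_hasDerivAt_right ?_
      (hc.stronglyMeasurableAtFilter isOpen_Ioi t ht) (hc.continuousAt (Ioi_mem_nhds ht))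
    refine (hc.mono ?_).intervalIntegrable
    rw [uIcc_of_le (by linarith)]
    exact fun u hu => ht2.trans_le hu.1
  refine (hI.const_sub (∫ u in Ioi (t / 2), h u)).congr_of_eventuallyEq ?_
  filter_upwards [lt_mem_nhds ht] with s hs
  rw [← intervalIntegral.integral_Ioi_sub_Ioi' (hi _ ht2) (hi _ hs), sub_sub_cancel]

/-- If `g u x` vanishes whenever some `x i` equals `u`, then `∫_{(t,∞)^k} g t x dx` can be
differentiated in `t` under the integral sign, the moving domain contributing nothing. -/
theorem hasDerivAt_setIntegral_orthant {g' : ℝ → (Fin k → ℝ) → ℝ} (hβ : 1 < β)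
    (hg' : ContinuousOn (fun q : ℝ × (Fin k → ℝ) => g' q.1 q.2) (Ioi 0 ×ˢ orthant k 0))
    (hd : ∀ u, 0 < u → ∀ x ∈ orthant k 0, HasDerivAt (fun v => g v x) (g' u x) u)
    (h0 : ∀ u, 0 < u → ∀ x ∈ orthant k 0, ∀ i, x i = u → g u x = 0)
    (hb : ∀ t, 0 < t → ∃ A, RpowBounded g' β t A) {t : ℝ} (ht : 0 < t) :
    HasDerivAt (fun s => ∫ x in orthant k s, g s x) (∫ x in orthant k t, g' t x) t := by
  cases k with
  | zero =>
    have huniv : ∀ s, orthant 0 s = univ := fun s => by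
      ext x
      simp
    simp only [huniv, Measure.restrict_univ, integral_unique]
    exact (hd t ht _ fun i => i.elim0).fun_const_smul (_ : ℝ)
  | succ k =>
    have hcont : ContinuousOn (fun u => ∫ x in orthant (k + 1) u, g' u x) (Ioi 0) :=
      fun s hs => (continuousAt_setIntegral_orthant hβ hg' hb hs).continuousWithinAt
    have hi : ∀ s, 0 < s → IntegrableOn (fun u => ∫ x in orthant (k + 1) u, g' u x) (Ioi s) := by
      intro s hs
      obtain ⟨A, hA⟩ := hb s hs
      exact (setIntegral_minRegion hβ hg' hs hA).1
    have h := (hasDerivAt_integral_Ioi hcont hi ht).neg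
    rw [neg_neg] at h
    refine h.congr_of_eventuallyEq ?_
    filter_upwards [lt_mem_nhds ht] with s hs
    obtain ⟨A, hA⟩ := hb s hs
    rw [Pi.neg_apply, ← (setIntegral_minRegion hβ hg' hs hA).2,
      setIntegral_minRegion_deriv hβ hg' hd h0 hs hA, neg_neg]

end Fubini

/-- The integral over `(t,∞)^{k+1}` of a symmetric function vanishing on ties is `k + 1` times its
integral over the region where the first coordinate is the smallest. -/
theorem setIntegral_orthant_succ {k : ℕ} {f : (Fin (k + 1) → ℝ) → ℝ} {t : ℝ}
    (hsymm : ∀ x (σ : Equiv.Perm (Fin (k + 1))), f (x ∘ σ) = f x)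
    (hties : ∀ x i j, i ≠ j → x i = x j → f x = 0)
    (hf : IntegrableOn f (orthant (k + 1) t)) :
    ∫ x in orthant (k + 1) t, f x =
      (k + 1) * ∫ q in minRegion k t, f (Fin.cons q.1 q.2 : Fin (k + 1) → ℝ) := by
  set e : Fin (k + 1) → ((Fin (k + 1) → ℝ) ≃ᵐ ℝ × (Fin k → ℝ)) :=
    fun i => MeasurableEquiv.piFinSuccAbove (fun _ => ℝ) i with he
  set T : Fin (k + 1) → Set (Fin (k + 1) → ℝ) := fun i => e i ⁻¹' minRegion k t with hT
  have hTmem : ∀ i x, x ∈ T i ↔ t < x i ∧ ∀ j, x i < x (i.succAbove j) := fun i x => Iff.rfl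
  have hTm : ∀ i, MeasurableSet (T i) := fun i =>
    (e i).measurable (isOpen_minRegion k t).measurableSet
  have hTsub : ∀ i, T i ⊆ orthant (k + 1) t := by
    intro i x hx j _
    rw [hTmem] at hx
    rcases Fin.eq_self_or_eq_succAbove i j with rfl | ⟨l, rfl⟩
    · exact hx.1
    · exact hx.1.trans (hx.2 l)
  have hpt : ∀ x, (orthant (k + 1) t).indicator f x = ∑ i, (T i).indicator f x := by
    intro x
    by_cases hx0 : f x = 0
    · simp [indicator, hx0]
    by_cases hx : x ∈ orthant (k + 1) t
    · obtain ⟨m, hm⟩ := Finite.exists_min x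
      rw [indicator_of_mem hx, Finset.sum_eq_single m, indicator_of_mem]
      · refine (hTmem m x).2 ⟨hx m (mem_univ m), fun j => (hm _).lt_of_ne fun h => hx0 ?_⟩
        exact hties x _ _ (Fin.succAbove_ne m j).symm h
      · intro i _ him
        refine indicator_of_notMem (fun h => ?_) _
        obtain ⟨l, hl⟩ := Fin.exists_succAbove_eq him.symm
        exact absurd (((hTmem i x).1 h).2 l) (not_lt.2 (hl ▸ hm i))
      · simp
    · rw [indicator_of_notMem hx, Finset.sum_eq_zero]
      exact fun i _ => indicator_of_notMem (fun h => hx (hTsub i h)) _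
  have hT_int : ∀ i, ∫ x in T i, f x =
      ∫ q in minRegion k t, f (Fin.cons q.1 q.2 : Fin (k + 1) → ℝ) := by
    intro i
    have h := (volume_preserving_piFinSuccAbove (fun _ : Fin (k + 1) => ℝ) i).setIntegral_preimage_emb
      (e i).measurableEmbedding
      (fun q => f (i.insertNth (α := fun _ => ℝ) q.1 q.2)) (minRegion k t)
    have h1 : ∀ x : Fin (k + 1) → ℝ, i.insertNth (α := fun _ => ℝ) (e i x).1 (e i x).2 = x :=
      fun x => (e i).symm_apply_apply x
    have h2 : ∀ q : ℝ × (Fin k → ℝ), f (i.insertNth (α := fun _ => ℝ) q.1 q.2) =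
        f (Fin.cons q.1 q.2 : Fin (k + 1) → ℝ) := by
      intro q
      rw [← Fin.insertNth_comp_cycleRange_symm i q.1 q.2, hsymm]
    simp only [h2] at h
    rw [← h]
    refine setIntegral_congr_fun (hTm i) fun x _ => ?_
    rw [← h2]
    exact congrArg f (h1 x).symm
  rw [← integral_indicator (measurableSet_orthant _ _)]
  simp only [hpt]
  rw [integral_finsetSum _ fun i _ => (hf.mono_set (hTsub i)).integrable_indicator (hTm i)]
  simp only [integral_indicator (hTm _), hT_int]
  simp

theorem succ_pow_succ_le (k : ℕ) : ((k : ℝ) + 1) ^ (k + 1) ≤ 3 * 6 ^ k * k.factorial := by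
  have h := Real.pow_div_factorial_le_exp ((k : ℝ) + 1) (by positivity) (k + 1)
  have he : Real.exp ((k : ℝ) + 1) ≤ 3 ^ (k + 1) := by
    rw [← Nat.cast_add_one, ← mul_one ((k + 1 : ℕ) : ℝ), Real.exp_nat_mul]
    exact pow_le_pow_left₀ (Real.exp_pos 1).le Real.exp_one_lt_three.le _
  have hk : (k : ℝ) + 1 ≤ 2 ^ k := by exact_mod_cast Nat.lt_two_pow_self (n := k)
  rw [div_le_iff₀ (by positivity), Nat.factorial_succ, Nat.cast_mul, Nat.cast_add_one] at h
  calc ((k : ℝ) + 1) ^ (k + 1) ≤ 3 ^ (k + 1) * (2 ^ k * k.factorial) := by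
        refine h.trans ?_
        gcongr
    _ = 3 * 6 ^ k * k.factorial := by
        rw [show (6 : ℝ) = 3 * 2 by norm_num, mul_pow]
        ring

theorem summable_sqrt_pow {c b : ℝ} (hc : 0 ≤ c) (hb : 0 ≤ b) :
    Summable fun k : ℕ => ((k : ℝ) + 1) ^ 2 * (√(((k : ℝ) + 1) ^ (k + 1)) * c ^ (k + 1)) *
      b ^ k / k.factorial := by
  set a := 4 * c * b with ha
  have ha0 : 0 ≤ a := by positivity
  have hs : Summable fun k : ℕ => c / 2 * (3 * (1 / 2 : ℝ) ^ k + (12 * a ^ 2) ^ k / k.factorial) :=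
    ((summable_geometric_two.mul_left 3).add
      (Real.summable_pow_div_factorial (12 * a ^ 2))).mul_left (c / 2)
  refine Summable.of_nonneg_of_le (fun k => by positivity) (fun k => ?_) hs
  have hk : (k : ℝ) + 1 ≤ 2 ^ k := by exact_mod_cast Nat.lt_two_pow_self (n := k)
  have hf : (0 : ℝ) < k.factorial := by positivity
  have hsqrt : √(((k : ℝ) + 1) ^ (k + 1)) * a ^ k ≤
      (3 * (1 / 2 : ℝ) ^ k * k.factorial + (12 * a ^ 2) ^ k) / 2 := by
    refine le_of_sq_le_sq ?_ (by positivity)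
    rw [mul_pow, Real.sq_sqrt (by positivity)]
    calc ((k : ℝ) + 1) ^ (k + 1) * (a ^ k) ^ 2 ≤ 3 * 6 ^ k * k.factorial * (a ^ k) ^ 2 := by
          gcongr
          exact succ_pow_succ_le k
      _ = (3 * (1 / 2 : ℝ) ^ k * k.factorial) * (12 * a ^ 2) ^ k := by
          rw [show (6 : ℝ) = 1 / 2 * 12 by norm_num, mul_pow (1 / 2), mul_pow 12, ← pow_mul,
            ← pow_mul, mul_comm k 2]
          ring
      _ ≤ _ := by nlinarith [sq_nonneg (3 * (1 / 2 : ℝ) ^ k * k.factorial - (12 * a ^ 2) ^ k)]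
  rw [div_le_iff₀ hf]
  calc ((k : ℝ) + 1) ^ 2 * (√(((k : ℝ) + 1) ^ (k + 1)) * c ^ (k + 1)) * b ^ k
      ≤ (2 ^ k) ^ 2 * (√(((k : ℝ) + 1) ^ (k + 1)) * c ^ (k + 1)) * b ^ k := by gcongr
    _ = c * (√(((k : ℝ) + 1) ^ (k + 1)) * a ^ k) := by
        rw [ha, mul_pow, mul_pow, show (4 : ℝ) = 2 ^ 2 by norm_num, ← pow_mul, ← pow_mul,
          mul_comm k 2]
        ring
    _ ≤ c * ((3 * (1 / 2 : ℝ) ^ k * k.factorial + (12 * a ^ 2) ^ k) / 2) := by gcongr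
    _ = _ := by field_simp

/-- On every `[t, ∞)`, the derivatives of order at most two in `u` of
`ρ_{k+1}(u, x₁, …, x_k)` are bounded by `A k * (u x₁ ⋯ x_k) ^ (-β)`, where `∑ A k b ^ k / k!`
converges for all `b ≥ 0`. -/
def RhoRpowBounded (K : ℝ → ℝ → ℝ) (β : ℝ) : Prop :=
  ∀ t, 0 < t → ∃ A : ℕ → ℝ, (∀ k, 0 ≤ A k) ∧
    (∀ b, 0 ≤ b → Summable fun k => A k * b ^ k / k.factorial) ∧
    ∀ k p, p ≤ 2 → RpowBounded (rhoD K k p) β t (A k)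

section Series

variable {K : ℝ → ℝ → ℝ} {β : ℝ}

theorem rhoRpowBounded (hK : ContDiffOn ℝ 2 (Function.uncurry K) (Ioi 0 ×ˢ Ioi 0))
    (hsymm : ∀ x y, 0 < x → 0 < y → K x y = K y x) {α : ℝ}
    (hbound : ∀ x₀ : ℝ, 0 < x₀ → ∃ C : ℝ, ∀ p q : ℕ, p + q ≤ 2 →
      ∀ x y : ℝ, x₀ ≤ x → x₀ ≤ y → |pderiv₂ K p q x y| ≤ C / (x * y) ^ α) :
    RhoRpowBounded K (2 * α) := by
  intro t ht
  obtain ⟨C, hC⟩ := hbound t ht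
  have hC0 : 0 ≤ C := by
    have h := (abs_nonneg _).trans (hC 0 0 (by norm_num) t t le_rfl le_rfl)
    rwa [le_div_iff₀ (by positivity), zero_mul] at h
  exact ⟨fun k => (k + 1) ^ 2 * (√(((k : ℝ) + 1) ^ (k + 1)) * (4 * C) ^ (k + 1)),
    fun k => by positivity, fun b hb => summable_sqrt_pow (by positivity) hb,
    fun k p hp u hu x hx => abs_rhoD_le hK hsymm ht hC hp hu hx⟩

theorem continuousOn_rhoD (hK : ContDiffOn ℝ 2 (Function.uncurry K) (Ioi 0 ×ˢ Ioi 0)) {k p : ℕ}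
    (hp : p ≤ 2) :
    ContinuousOn (fun q : ℝ × (Fin k → ℝ) => rhoD K k p q.1 q.2) (Ioi 0 ×ˢ orthant k 0) :=
  (contDiffOn_rhoD hK (n := 0) (by omega)).continuousOn

theorem RhoRpowBounded.exists_rpowBounded (hb : RhoRpowBounded K β) {k p : ℕ} (hp : p ≤ 2) :
    ∀ t, 0 < t → ∃ A, RpowBounded (rhoD K k p) β t A := fun t ht =>
  let ⟨A, _, _, hA⟩ := hb t ht
  ⟨A k, hA k p hp⟩

/-- A summable bound, uniform in `u ≥ t`, for the terms of the series of absolute values. -/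
theorem exists_summable_bound_rhoD
    (hK : ContDiffOn ℝ 2 (Function.uncurry K) (Ioi 0 ×ˢ Ioi 0)) (hβ : 1 < β)
    (hb : RhoRpowBounded K β) {t : ℝ} (ht : 0 < t) :
    ∃ M : ℕ → ℝ, Summable M ∧ ∀ k p, p ≤ 2 → ∀ u, t ≤ u →
      ((1 : ℝ) / k.factorial) * ∫ x in orthant k u, |rhoD K k p u x| ≤ M k := by
  obtain ⟨A, hA0, hAs, hA⟩ := hb t ht
  have hI : 0 ≤ ∫ v in Ioi t, v ^ (-β) :=
    setIntegral_nonneg measurableSet_Ioi fun v hv => Real.rpow_nonneg (ht.trans hv).le _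
  refine ⟨_, (hAs _ hI).mul_left (t ^ (-β)), fun k p hp u hu => ?_⟩
  calc ((1 : ℝ) / k.factorial) * ∫ x in orthant k u, |rhoD K k p u x|
      ≤ (1 / k.factorial) * (A k * (t ^ (-β) * (∫ v in Ioi t, v ^ (-β)) ^ k)) := by
        gcongr
        exact setIntegral_abs_section_le hβ (continuousOn_rhoD hK hp) ht (hA0 k) (hA k p hp) hu
    _ = _ := by ring

theorem summable_setIntegral_abs_rhoD
    (hK : ContDiffOn ℝ 2 (Function.uncurry K) (Ioi 0 ×ˢ Ioi 0)) (hβ : 1 < β)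
    (hb : RhoRpowBounded K β) {p : ℕ} (hp : p ≤ 2) {t : ℝ} (ht : 0 < t) :
    Summable fun k : ℕ => ((1 : ℝ) / k.factorial) * ∫ x in orthant k t, |rhoD K k p t x| := by
  obtain ⟨M, hM, hle⟩ := exists_summable_bound_rhoD hK hβ hb ht
  refine hM.of_nonneg_of_le (fun k => ?_) fun k => hle k p hp t le_rfl
  exact mul_nonneg (by positivity) (integral_nonneg fun _ => abs_nonneg _)

theorem norm_term_le (k : ℕ) (s : Set (Fin k → ℝ)) (f : (Fin k → ℝ) → ℝ) :
    ‖((-1 : ℝ) ^ k / k.factorial) * ∫ x in s, f x‖ ≤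
      ((1 : ℝ) / k.factorial) * ∫ x in s, |f x| := by
  rw [norm_mul, norm_div, norm_pow, norm_neg, norm_one, one_pow, RCLike.norm_natCast]
  gcongr
  exact norm_integral_le_integral_norm f

theorem abs_rhoK_le {t A : ℝ} {k : ℕ} (hA : RpowBounded (rhoD K k 0) β t A)
    {x : Fin (k + 1) → ℝ} (hx : ∀ i, t ≤ x i) : |rhoK K (k + 1) x| ≤ A * ∏ i, x i ^ (-β) := by
  have h := hA (x 0) (hx 0) (Fin.tail x) fun i => hx i.succ
  rw [rhoD_zero, Fin.cons_self_tail] at h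
  rwa [Fin.prod_univ_succ]

theorem integrableOn_rhoK (hK : ContDiffOn ℝ 2 (Function.uncurry K) (Ioi 0 ×ˢ Ioi 0))
    (hβ : 1 < β) (hb : RhoRpowBounded K β) {t : ℝ} (ht : 0 < t) (k : ℕ) :
    IntegrableOn (rhoK K (k + 1)) (orthant (k + 1) t) := by
  obtain ⟨A, -, -, hA⟩ := hb t ht
  refine Integrable.mono' ((integrableOn_prod_rpow hβ ht (k + 1)).const_mul (A k))
    (((contDiffOn_rhoK hK (k + 1)).continuousOn.mono
      (orthant_subset ht.le)).aestronglyMeasurable (measurableSet_orthant _ t)) ?_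
  filter_upwards [ae_restrict_mem (measurableSet_orthant _ t)] with x hx
  exact abs_rhoK_le (hA k 0 (by norm_num)) fun i => (hx i (mem_univ i)).le

theorem summable_setIntegral_abs_rhoK
    (hK : ContDiffOn ℝ 2 (Function.uncurry K) (Ioi 0 ×ˢ Ioi 0)) (hβ : 1 < β)
    (hb : RhoRpowBounded K β) {t : ℝ} (ht : 0 < t) :
    Summable fun k : ℕ => (1 / (k + 1).factorial : ℝ) *
      ∫ x in orthant (k + 1) t, |rhoK K (k + 1) x| := by
  obtain ⟨A, hA0, hAs, hA⟩ := hb t ht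
  set I := ∫ v in Ioi t, v ^ (-β) with hIdef
  have hI : 0 ≤ I :=
    setIntegral_nonneg measurableSet_Ioi fun v hv => Real.rpow_nonneg (ht.trans hv).le _
  refine ((hAs I hI).mul_left I).of_nonneg_of_le (fun k => ?_) fun k => ?_
  · exact mul_nonneg (by positivity) (integral_nonneg fun _ => abs_nonneg _)
  have hint : ∫ x in orthant (k + 1) t, |rhoK K (k + 1) x| ≤ A k * I ^ (k + 1) := by
    rw [hIdef, ← setIntegral_prod_rpow, ← integral_const_mul]
    refine setIntegral_mono_on (integrableOn_rhoK hK hβ hb ht k).abs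
      ((integrableOn_prod_rpow hβ ht (k + 1)).const_mul _) (measurableSet_orthant _ t)
      fun x hx => ?_
    exact abs_rhoK_le (hA k 0 (by norm_num)) fun i => (hx i (mem_univ i)).le
  have hA0k := hA0 k
  calc (1 / (k + 1).factorial : ℝ) * ∫ x in orthant (k + 1) t, |rhoK K (k + 1) x|
      ≤ (1 / k.factorial : ℝ) * (A k * I ^ (k + 1)) := by
        refine mul_le_mul ?_ hint (integral_nonneg fun _ => abs_nonneg _) (by positivity)
        gcongr
        exact k.le_succ
    _ = I * (A k * I ^ k / k.factorial) := by ring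

/-- The series `∑ (-1)^k / k! ∫_{(t,∞)^k} ∂ᵖ/∂tᵖ ρ_{k+1}(t, x₁, …, x_k)`. -/
def rhoSeries (K : ℝ → ℝ → ℝ) (p : ℕ) (t : ℝ) : ℝ :=
  ∑' k : ℕ, ((-1 : ℝ) ^ k / k.factorial) * ∫ x in orthant k t, rhoD K k p t x

theorem hasDerivAt_rhoSeries (hK : ContDiffOn ℝ 2 (Function.uncurry K) (Ioi 0 ×ˢ Ioi 0))
    (hpos : ∀ (k : ℕ) (x : Fin k → ℝ), (∀ i, 0 < x i) →
      (Matrix.of fun i j => K (x i) (x j)).PosSemidef)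
    (hβ : 1 < β) (hb : RhoRpowBounded K β) {p : ℕ} (hp : p ≤ 1) {t : ℝ} (ht : 0 < t) :
    HasDerivAt (rhoSeries K p) (rhoSeries K (p + 1) t) t := by
  have ht2 : 0 < t / 2 := by linarith
  have htt : t ∈ Ioi (t / 2) := by
    rw [mem_Ioi]
    linarith
  obtain ⟨M, hM, hle⟩ := exists_summable_bound_rhoD hK hβ hb ht2
  refine hasDerivAt_tsum_of_isPreconnected (t := Ioi (t / 2)) (y₀ := t)
    (g := fun k s => ((-1 : ℝ) ^ k / k.factorial) * ∫ x in orthant k s, rhoD K k p s x)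
    (g' := fun k s => ((-1 : ℝ) ^ k / k.factorial) * ∫ x in orthant k s, rhoD K k (p + 1) s x)
    hM isOpen_Ioi
    isPreconnected_Ioi (fun k y hy => ?_) (fun k y hy => ?_) htt ?_ htt
  · have h := hasDerivAt_setIntegral_orthant hβ (continuousOn_rhoD (k := k) hK (by omega))
      (fun u hu x hx => hasDerivAt_rhoD hK hp hu fun i => hx i (mem_univ i))
      (fun u hu x hx i hi => rhoD_eq_zero hpos hp hu (fun i => hx i (mem_univ i)) hi)
      (hb.exists_rpowBounded (by omega)) (ht2.trans hy)
    exact h.const_mul _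
  · exact (norm_term_le k _ _).trans (hle k (p + 1) (by omega) y (le_of_lt hy))
  · exact Summable.of_norm_bounded
      (summable_setIntegral_abs_rhoD hK hβ hb (by omega : p ≤ 2) ht) fun k => norm_term_le k _ _

theorem continuousOn_rhoSeries (hK : ContDiffOn ℝ 2 (Function.uncurry K) (Ioi 0 ×ˢ Ioi 0))
    (hβ : 1 < β) (hb : RhoRpowBounded K β) {p : ℕ} (hp : p ≤ 2) :
    ContinuousOn (rhoSeries K p) (Ioi 0) := by
  intro t ht
  rw [mem_Ioi] at ht
  have ht2 : 0 < t / 2 := by linarith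
  obtain ⟨M, hM, hle⟩ := exists_summable_bound_rhoD hK hβ hb ht2
  refine ContinuousAt.continuousWithinAt (ContinuousOn.continuousAt (s := Ioi (t / 2)) ?_
    (Ioi_mem_nhds (by linarith)))
  refine continuousOn_tsum (fun k y hy => ?_) hM fun k y hy =>
    (norm_term_le k _ _).trans (hle k p hp y (le_of_lt hy))
  exact ((continuousAt_setIntegral_orthant hβ (continuousOn_rhoD hK hp)
    (hb.exists_rpowBounded hp) (ht2.trans hy)).const_mul _).continuousWithinAt

theorem setIntegral_rhoK_eq (hK : ContDiffOn ℝ 2 (Function.uncurry K) (Ioi 0 ×ˢ Ioi 0))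
    (hβ : 1 < β) (hb : RhoRpowBounded K β) {t : ℝ} (ht : 0 < t) (k : ℕ) :
    ∫ x in orthant (k + 1) t, rhoK K (k + 1) x =
      (k + 1) * ∫ u in Ioi t, ∫ x in orthant k u, rhoD K k 0 u x := by
  obtain ⟨A, hA⟩ := hb.exists_rpowBounded (k := k) (p := 0) (by norm_num) t ht
  rw [setIntegral_orthant_succ rhoK_comp_perm (fun x i j hij h => rhoK_eq_zero_of_eq hij h)
    (integrableOn_rhoK hK hβ hb ht k),
    ← (setIntegral_minRegion hβ (continuousOn_rhoD hK (by norm_num)) ht hA).2]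
  simp only [rhoD_zero]

theorem hasDerivAt_fredholm_term (hK : ContDiffOn ℝ 2 (Function.uncurry K) (Ioi 0 ×ˢ Ioi 0))
    (hβ : 1 < β) (hb : RhoRpowBounded K β) {t : ℝ} (ht : 0 < t) (k : ℕ) :
    HasDerivAt (fun s => ((-1 : ℝ) ^ (k + 1) / (k + 1).factorial) *
        ∫ x in orthant (k + 1) s, rhoK K (k + 1) x)
      (((-1 : ℝ) ^ k / k.factorial) * ∫ x in orthant k t, rhoD K k 0 t x) t := by
  have hc : ContinuousOn (fun u => ∫ x in orthant k u, rhoD K k 0 u x) (Ioi 0) := fun u hu =>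
    (continuousAt_setIntegral_orthant hβ (continuousOn_rhoD hK (by norm_num))
      (hb.exists_rpowBounded (by norm_num)) hu).continuousWithinAt
  have hi : ∀ s, 0 < s → IntegrableOn (fun u => ∫ x in orthant k u, rhoD K k 0 u x) (Ioi s) :=
    fun s hs =>
      let ⟨_, hA⟩ := hb.exists_rpowBounded (k := k) (p := 0) (by norm_num) s hs
      (setIntegral_minRegion hβ (continuousOn_rhoD hK (by norm_num)) hs hA).1
  refine (((hasDerivAt_integral_Ioi hc hi ht).const_mul ((-1 : ℝ) ^ (k + 1) / k.factorial)
    ).congr_of_eventuallyEq ?_).congr_deriv (by ring)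
  filter_upwards [lt_mem_nhds ht] with s hs
  rw [setIntegral_rhoK_eq hK hβ hb hs, Nat.factorial_succ, Nat.cast_mul, Nat.cast_add_one]
  field_simp

theorem hasDerivAt_fredholmDet (hK : ContDiffOn ℝ 2 (Function.uncurry K) (Ioi 0 ×ˢ Ioi 0))
    (hβ : 1 < β) (hb : RhoRpowBounded K β) {t : ℝ} (ht : 0 < t) :
    HasDerivAt (fredholmDet K) (rhoSeries K 0 t) t := by
  have ht2 : 0 < t / 2 := by linarith
  have htt : t ∈ Ioi (t / 2) := by
    rw [mem_Ioi]
    linarith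
  obtain ⟨M, hM, hle⟩ := exists_summable_bound_rhoD hK hβ hb ht2
  suffices h : HasDerivAt (fun s => ∑' k : ℕ, ((-1 : ℝ) ^ (k + 1) / (k + 1).factorial) *
      ∫ x in orthant (k + 1) s, rhoK K (k + 1) x) (rhoSeries K 0 t) t from h.const_add 1
  refine hasDerivAt_tsum_of_isPreconnected (t := Ioi (t / 2)) (y₀ := t) hM
    isOpen_Ioi isPreconnected_Ioi
    (fun k y hy => hasDerivAt_fredholm_term hK hβ hb (ht2.trans hy) k)
    (fun k y hy => (norm_term_le k _ _).trans (hle k 0 (by norm_num) y (le_of_lt hy))) htt ?_ htt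
  exact Summable.of_norm_bounded (summable_setIntegral_abs_rhoK hK hβ hb ht)
    fun k => norm_term_le (k + 1) _ _

end Series

theorem contDiffOn_succ_of_hasDerivAt {f f' : ℝ → ℝ} {s : Set ℝ} (hs : IsOpen s) {n : ℕ}
    (hd : ∀ t ∈ s, HasDerivAt f (f' t) t) (hf' : ContDiffOn ℝ n f' s) :
    ContDiffOn ℝ (n + 1) f s := by
  rw [contDiffOn_succ_iff_deriv_of_isOpen hs]
  exact ⟨fun t ht => (hd t ht).differentiableAt.differentiableWithinAt, by simp,
    hf'.congr fun t ht => (hd t ht).deriv⟩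

/-- Under the hypotheses of the key estimate lemma, the series
`∑_{k≥1} (1/k!)∫_{(t,∞)^k} ρ_k` converges, the Fredholm determinant is `C³` on `(0,∞)`,
and its first three derivatives are given by the absolutely convergent sums of integrals of
`ρ_{k+1}(t,x₁,…,x_k)` and of its first and second partial derivatives in `t`. -/
theorem fredholmDet_contDiff_and_derivatives (K : ℝ → ℝ → ℝ)
    (hK : ContDiffOn ℝ 2 (Function.uncurry K) (Set.Ioi 0 ×ˢ Set.Ioi 0))
    (hpos : ∀ (k : ℕ) (x : Fin k → ℝ), (∀ i, 0 < x i) →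
      (Matrix.of fun i j => K (x i) (x j)).PosSemidef)
    (α : ℝ) (hα : 1 / 2 < α)
    (hbound : ∀ x₀ : ℝ, 0 < x₀ → ∃ C : ℝ, ∀ p q : ℕ, p + q ≤ 2 →
      ∀ x y : ℝ, x₀ ≤ x → x₀ ≤ y → |pderiv₂ K p q x y| ≤ C / (x * y) ^ α) :
    (∀ t : ℝ, 0 < t →
      (∀ k : ℕ, MeasureTheory.IntegrableOn (rhoK K (k + 1))
        (Set.univ.pi fun _ : Fin (k + 1) => Set.Ioi t)) ∧
      Summable fun k : ℕ => (1 / (k + 1).factorial : ℝ) *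
        ∫ x : Fin (k + 1) → ℝ in Set.univ.pi fun _ => Set.Ioi t, |rhoK K (k + 1) x|) ∧
    ContDiffOn ℝ 3 (fredholmDet K) (Set.Ioi 0) ∧
    (∀ t : ℝ, 0 < t →
      (Summable fun k : ℕ => ((1 : ℝ) / k.factorial) *
        ∫ x : Fin k → ℝ in Set.univ.pi fun _ => Set.Ioi t,
          |rhoK K (k + 1) (Fin.cons t x)|) ∧
      deriv (fredholmDet K) t = ∑' k : ℕ, ((-1 : ℝ) ^ k / k.factorial) *
        ∫ x : Fin k → ℝ in Set.univ.pi fun _ => Set.Ioi t, rhoK K (k + 1) (Fin.cons t x)) ∧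
    (∀ t : ℝ, 0 < t →
      (Summable fun k : ℕ => ((1 : ℝ) / k.factorial) *
        ∫ x : Fin k → ℝ in Set.univ.pi fun _ => Set.Ioi t,
          |deriv (fun u => rhoK K (k + 1) (Fin.cons u x)) t|) ∧
      deriv (deriv (fredholmDet K)) t = ∑' k : ℕ, ((-1 : ℝ) ^ k / k.factorial) *
        ∫ x : Fin k → ℝ in Set.univ.pi fun _ => Set.Ioi t,
          deriv (fun u => rhoK K (k + 1) (Fin.cons u x)) t) ∧
    ∀ t : ℝ, 0 < t →
      (Summable fun k : ℕ => ((1 : ℝ) / k.factorial) *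
        ∫ x : Fin k → ℝ in Set.univ.pi fun _ => Set.Ioi t,
          |iteratedDeriv 2 (fun u => rhoK K (k + 1) (Fin.cons u x)) t|) ∧
      deriv (deriv (deriv (fredholmDet K))) t = ∑' k : ℕ, ((-1 : ℝ) ^ k / k.factorial) *
        ∫ x : Fin k → ℝ in Set.univ.pi fun _ => Set.Ioi t,
          iteratedDeriv 2 (fun u => rhoK K (k + 1) (Fin.cons u x)) t := by
  have hβ : 1 < 2 * α := by linarith
  have hsymm : ∀ x y, 0 < x → 0 < y → K x y = K y x := fun x y hx hy => by
    have h := (hpos 2 ![x, y] (by simp [Fin.forall_fin_two, hx, hy])).isHermitian.apply 1 0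
    simpa using h
  have hb := rhoRpowBounded hK hsymm hbound
  have hF : ∀ t ∈ Ioi (0 : ℝ), HasDerivAt (fredholmDet K) (rhoSeries K 0 t) t :=
    fun t ht => hasDerivAt_fredholmDet hK hβ hb ht
  have hS : ∀ p, p ≤ 1 → ∀ t ∈ Ioi (0 : ℝ),
      HasDerivAt (rhoSeries K p) (rhoSeries K (p + 1) t) t :=
    fun p hp t ht => hasDerivAt_rhoSeries hK hpos hβ hb hp ht
  have hF₂ : ∀ t ∈ Ioi (0 : ℝ), HasDerivAt (deriv (fredholmDet K)) (rhoSeries K 1 t) t :=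
    fun t ht => (hS 0 zero_le_one t ht).congr_of_eventuallyEq
      (eventually_of_mem (Ioi_mem_nhds ht) fun s hs => (hF s hs).deriv)
  have hF₃ : ∀ t ∈ Ioi (0 : ℝ), HasDerivAt (deriv (deriv (fredholmDet K))) (rhoSeries K 2 t) t :=
    fun t ht => (hS 1 le_rfl t ht).congr_of_eventuallyEq
      (eventually_of_mem (Ioi_mem_nhds ht) fun s hs => (hF₂ s hs).deriv)
  have h₁ : ∀ k u (x : Fin k → ℝ),
      deriv (fun v => rhoK K (k + 1) (Fin.cons v x)) u = rhoD K k 1 u x :=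
    fun k u x => by rw [rhoD, iteratedDeriv_one]
  have hcont : ContDiffOn ℝ ((2 : ℕ) + 1) (fredholmDet K) (Ioi 0) := by
    refine contDiffOn_succ_of_hasDerivAt isOpen_Ioi hF ?_
    refine contDiffOn_succ_of_hasDerivAt (n := 1) isOpen_Ioi (hS 0 zero_le_one) ?_
    refine contDiffOn_succ_of_hasDerivAt (n := 0) isOpen_Ioi (hS 1 le_rfl) ?_
    exact contDiffOn_zero.2 (continuousOn_rhoSeries hK hβ hb le_rfl)
  refine ⟨fun t ht => ⟨integrableOn_rhoK hK hβ hb ht, summable_setIntegral_abs_rhoK hK hβ hb ht⟩,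
    by simpa using! hcont, fun t ht => ?_, fun t ht => ?_, fun t ht =>
      ⟨summable_setIntegral_abs_rhoD hK hβ hb le_rfl ht, (hF₃ t ht).deriv⟩⟩
  · simp only [← rhoD_zero]
    exact ⟨summable_setIntegral_abs_rhoD hK hβ hb (by norm_num) ht, (hF t ht).deriv⟩
  · simp only [h₁]
    exact ⟨summable_setIntegral_abs_rhoD hK hβ hb (by norm_num) ht, (hF₂ t ht).deriv⟩
end
end

section
/- Let n ≥ 1 and let A and B be real symmetric positive semidefinite n × n matrices such that |A_{ij}| ≤ α and |B_{ij}| ≤ α for all 1 ≤ i,j ≤ n and |A_{ij} − B_{ij}| ≤ β for all 1 ≤ i,j ≤ n, where α, β > 0. Then |det(B) − det(A)| ≤ β · n² · α^{n−1}. -/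
noncomputable section

open Complex MeasureTheory Filter Set

open scoped Matrix MatrixOrder in
theorem Matrix.PosSemidef.adjugate {ι : Type*} [Fintype ι] [DecidableEq ι] {M : Matrix ι ι ℝ}
    (hM : M.PosSemidef) : M.adjugate.PosSemidef := by
  obtain ⟨X, rfl⟩ := CStarAlgebra.nonneg_iff_eq_star_mul_self.mp hM.nonneg
  rw [Matrix.adjugate_mul_distrib, Matrix.star_eq_conjTranspose, ← Matrix.adjugate_conjTranspose]
  exact Matrix.posSemidef_self_mul_conjTranspose _

/-- **Hadamard's inequality** for positive semidefinite matrices, in the form of a uniform bound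
on the diagonal. -/
theorem Matrix.PosSemidef.det_le_pow {ι : Type*} [Fintype ι] [DecidableEq ι] {M : Matrix ι ι ℝ}
    (hM : M.PosSemidef) {a : ℝ} (ha : 0 < a) (hdiag : ∀ i, M i i ≤ a) :
    M.det ≤ a ^ Fintype.card ι := by
  have htr : ∑ i, hM.1.eigenvalues i = M.trace := by
    simpa using hM.1.trace_eq_sum_eigenvalues.symm
  have hdet : M.det = ∏ i, hM.1.eigenvalues i := by
    simpa using hM.1.det_eq_prod_eigenvalues
  have hle : M.trace ≤ Fintype.card ι * a := by
    simpa [Matrix.trace] using Finset.sum_le_sum fun i (_ : i ∈ Finset.univ) => hdiag i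
  have hprod : ∏ i, hM.1.eigenvalues i / a ≤ 1 := by
    calc ∏ i, hM.1.eigenvalues i / a
        ≤ ∏ i, Real.exp (hM.1.eigenvalues i / a - 1) := by
          refine Finset.prod_le_prod (fun i _ => div_nonneg (hM.eigenvalues_nonneg i) ha.le)
            fun i _ => ?_
          linarith [Real.add_one_le_exp (hM.1.eigenvalues i / a - 1)]
      _ = Real.exp (M.trace / a - Fintype.card ι) := by
          rw [← Real.exp_sum, Finset.sum_sub_distrib, ← Finset.sum_div, htr]
          simp
      _ ≤ 1 := by
          rw [Real.exp_le_one_iff, sub_nonpos, div_le_iff₀ ha]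
          exact hle
  rw [Finset.prod_div_distrib, Finset.prod_const, Finset.card_univ,
    div_le_one (pow_pos ha _)] at hprod
  rwa [hdet]

/-- The entries of a positive semidefinite matrix are bounded by any bound on its diagonal. -/
theorem Matrix.PosSemidef.abs_apply_le {ι : Type*} [Fintype ι] [DecidableEq ι] {M : Matrix ι ι ℝ}
    (hM : M.PosSemidef) {a : ℝ} (hdiag : ∀ i, M i i ≤ a) (i j : ι) : |M i j| ≤ a := by
  have hsymm : M j i = M i j := by simpa using hM.1.apply i j
  have hadd := hM.dotProduct_mulVec_nonneg (Pi.single i 1 + Pi.single j 1)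
  have hsub := hM.dotProduct_mulVec_nonneg (Pi.single i 1 - Pi.single j 1)
  simp [Matrix.mulVec_add, Matrix.mulVec_sub, add_dotProduct, sub_dotProduct] at hadd hsub
  rw [abs_le]
  constructor <;> linarith [hdiag i, hdiag j]

/-- Cofactors of a positive semidefinite matrix are controlled by its diagonal. -/
theorem Matrix.PosSemidef.abs_adjugate_apply_le {m : ℕ} {M : Matrix (Fin (m + 1)) (Fin (m + 1)) ℝ}
    (hM : M.PosSemidef) {a : ℝ} (ha : 0 < a) (hdiag : ∀ i, M i i ≤ a) (i j : Fin (m + 1)) :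
    |M.adjugate i j| ≤ a ^ m := by
  refine hM.adjugate.abs_apply_le (fun k => ?_) i j
  rw [Matrix.adjugate_fin_succ_eq_det_submatrix, ← two_mul, pow_mul, neg_one_sq, one_pow, one_mul]
  simpa using (hM.submatrix k.succAbove).det_le_pow ha fun l => hdiag _

/-- **Jacobi's formula** along a line in the space of matrices. -/
theorem Matrix.hasDerivAt_det_add_smul {ι : Type*} [Fintype ι] [DecidableEq ι] (A D : Matrix ι ι ℝ)
    (t : ℝ) :
    HasDerivAt (fun s : ℝ => (A + s • D).det)
      (∑ i, ∑ j, (A + t • D).adjugate j i * D i j) t := by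
  let f : ContinuousMultilinearMap ℝ (fun _ : ι => ι → ℝ) ℝ :=
    { (Matrix.detRowAlternating (n := ι) (R := ℝ)).toMultilinearMap with
      cont := Continuous.matrix_det (A := fun M : Matrix ι ι ℝ => M) continuous_id }
  have hline : HasDerivAt (fun (s : ℝ) (i : ι) => A i + s • D i) (fun i => D i) t :=
    hasDerivAt_pi.2 fun i => by
      simpa using ((hasDerivAt_id t).smul_const (D i)).const_add (A i)
  refine ((f.hasFDerivAt _).comp_hasDerivAt t hline).congr_deriv ?_
  rw [ContinuousMultilinearMap.linearDeriv_apply]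
  refine Finset.sum_congr rfl fun i _ => ?_
  change ((A + t • D).updateRow i (D i)).det = _
  rw [← Matrix.cramer_transpose_apply, Matrix.cramer_eq_adjugate_mulVec,
    ← Matrix.adjugate_transpose]
  rfl

/-- Lipschitz-type bound for the determinant on positive semidefinite
matrices: if `A, B` are real symmetric positive semidefinite `n × n` matrices with
`|A_{ij}|, |B_{ij}| ≤ α` and `|A_{ij} − B_{ij}| ≤ β`, then
`|det B − det A| ≤ β n² α^{n−1}`. -/
theorem det_diff_bound (n : ℕ) (hn : 1 ≤ n) (A B : Matrix (Fin n) (Fin n) ℝ)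
    (hA : A.PosSemidef) (hB : B.PosSemidef) (α β : ℝ) (hα : 0 < α) (hβ : 0 < β)
    (hAα : ∀ i j, |A i j| ≤ α) (hBα : ∀ i j, |B i j| ≤ α)
    (hAB : ∀ i j, |A i j - B i j| ≤ β) :
    |B.det - A.det| ≤ β * (n : ℝ) ^ 2 * α ^ (n - 1) := by
  obtain ⟨m, rfl⟩ : ∃ m, n = m + 1 := ⟨n - 1, by omega⟩
  have hderiv : ∀ t ∈ Set.Ico (0 : ℝ) 1,
      ‖∑ i, ∑ j, (A + t • (B - A)).adjugate j i * (B - A) i j‖ ≤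
        β * ((m + 1 : ℕ) : ℝ) ^ 2 * α ^ m := by
    intro t ht
    have hC : A + t • (B - A) = (1 - t) • A + t • B := by module
    have hpos : (A + t • (B - A)).PosSemidef := by
      rw [hC]
      exact (hA.smul (by linarith [ht.2])).add (hB.smul ht.1)
    have hdiag : ∀ i, (A + t • (B - A)) i i ≤ α := by
      intro i
      rw [hC]
      simp only [Matrix.add_apply, Matrix.smul_apply, smul_eq_mul]
      nlinarith [ht.1, ht.2, (abs_le.1 (hAα i i)).2, (abs_le.1 (hBα i i)).2]
    calc ‖∑ i, ∑ j, (A + t • (B - A)).adjugate j i * (B - A) i j‖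
        ≤ ∑ _i : Fin (m + 1), ∑ _j : Fin (m + 1), α ^ m * β := by
          refine norm_sum_le_of_le _ fun i _ => norm_sum_le_of_le _ fun j _ => ?_
          rw [norm_mul]
          refine mul_le_mul (hpos.abs_adjugate_apply_le hα hdiag j i) ?_ (norm_nonneg _)
            (pow_nonneg hα.le m)
          rw [Matrix.sub_apply, norm_sub_rev]
          exact hAB i j
      _ = β * ((m + 1 : ℕ) : ℝ) ^ 2 * α ^ m := by
          simp only [Finset.sum_const, Finset.card_univ, Fintype.card_fin, nsmul_eq_mul]
          ring
  simpa using norm_image_sub_le_of_norm_deriv_le_segment_01'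
    (fun t _ => (Matrix.hasDerivAt_det_add_smul A (B - A) t).hasDerivWithinAt) hderiv
end
end

section
/- Let s ∈ ℂ with Re(s) > −1/2. For every x₀ > 0 there exists a constant C(x₀,s) > 0, depending only on x₀ and s, such that for all N ≥ 1 and all x, y > x₀: |K_[N](x,y) − K_∞(x,y)| ≤ (1/N) · C(x₀,s)/(xy)^{Re(s)+1}. -/
noncomputable section

open Complex MeasureTheory Filter Set

/-- `f N` converges to the bounded function `g` uniformly on `S`, at rate `1 / N`. -/
def UniformRate {α : Type*} (S : Set α) (f : ℕ → α → ℂ) (g : α → ℂ) : Prop :=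
  ∃ C : ℝ, 0 ≤ C ∧ ∀ N : ℕ, 1 ≤ N → ∀ a ∈ S, ‖f N a - g a‖ ≤ C / N ∧ ‖g a‖ ≤ C

namespace UniformRate

variable {α β : Type*} {S : Set α} {f f₁ f₂ : ℕ → α → ℂ} {g g₁ g₂ : α → ℂ}

theorem congr (h : UniformRate S f g) (hf : ∀ N, 1 ≤ N → ∀ a ∈ S, f₁ N a = f N a)
    (hg : ∀ a ∈ S, g₁ a = g a) : UniformRate S f₁ g₁ := by
  obtain ⟨C, hC, h⟩ := h
  exact ⟨C, hC, fun N hN a ha => by rw [hf N hN a ha, hg a ha]; exact h N hN a ha⟩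

theorem of_bound {C D : ℝ} (hf : ∀ N : ℕ, 1 ≤ N → ∀ a ∈ S, ‖f N a - g a‖ ≤ C / N)
    (hg : ∀ a ∈ S, ‖g a‖ ≤ D) : UniformRate S f g := by
  refine ⟨|C| + |D|, by positivity, fun N hN a ha => ⟨(hf N hN a ha).trans ?_, ?_⟩⟩
  · have := le_abs_self C
    have := abs_nonneg D
    gcongr
    linarith
  · linarith [hg a ha, le_abs_self D, abs_nonneg C]

theorem const_right {D : ℝ} (hg : ∀ a ∈ S, ‖g a‖ ≤ D) : UniformRate S (fun _ => g) g :=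
  of_bound (C := 0) (by simp) hg

theorem comap (h : UniformRate S f g) (φ : β → α) {T : Set β} (hφ : MapsTo φ T S) :
    UniformRate T (fun N b => f N (φ b)) (fun b => g (φ b)) := by
  obtain ⟨C, hC, h⟩ := h
  exact ⟨C, hC, fun N hN b hb => h N hN (φ b) (hφ hb)⟩

theorem add (h₁ : UniformRate S f₁ g₁) (h₂ : UniformRate S f₂ g₂) :
    UniformRate S (fun N a => f₁ N a + f₂ N a) (fun a => g₁ a + g₂ a) := by
  obtain ⟨C, hC, h₁⟩ := h₁
  obtain ⟨D, hD, h₂⟩ := h₂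
  refine ⟨C + D, by positivity, fun N hN a ha => ⟨?_, ?_⟩⟩
  · rw [add_sub_add_comm, add_div]
    exact (norm_add_le _ _).trans (add_le_add (h₁ N hN a ha).1 (h₂ N hN a ha).1)
  · exact (norm_add_le _ _).trans (add_le_add (h₁ N hN a ha).2 (h₂ N hN a ha).2)

theorem norm_le (h : UniformRate S f g) :
    ∃ R : ℝ, 0 ≤ R ∧ ∀ N : ℕ, 1 ≤ N → ∀ a ∈ S, ‖f N a‖ ≤ R ∧ ‖g a‖ ≤ R := by
  obtain ⟨C, hC, h⟩ := h
  refine ⟨C + C, by positivity, fun N hN a ha => ⟨?_, by linarith [(h N hN a ha).2]⟩⟩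
  have hN' : (1 : ℝ) ≤ N := by exact_mod_cast hN
  have h1 := (h N hN a ha).1.trans (div_le_self hC hN')
  have h2 := norm_add_le (f N a - g a) (g a)
  rw [sub_add_cancel] at h2
  linarith [(h N hN a ha).2]

theorem mul (h₁ : UniformRate S f₁ g₁) (h₂ : UniformRate S f₂ g₂) :
    UniformRate S (fun N a => f₁ N a * f₂ N a) (fun a => g₁ a * g₂ a) := by
  obtain ⟨R, hR, hb⟩ := h₁.norm_le
  obtain ⟨C, hC, h₁⟩ := h₁
  obtain ⟨D, hD, h₂⟩ := h₂
  refine of_bound (C := R * D + C * D) (D := C * D) (fun N hN a ha => ?_) (fun a ha => ?_)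
  · have e : f₁ N a * f₂ N a - g₁ a * g₂ a =
        f₁ N a * (f₂ N a - g₂ a) + (f₁ N a - g₁ a) * g₂ a := by ring
    rw [e, add_div, mul_div_assoc, mul_div_right_comm]
    refine (norm_add_le _ _).trans ?_
    rw [norm_mul, norm_mul]
    exact add_le_add
      (mul_le_mul (hb N hN a ha).1 (h₂ N hN a ha).1 (norm_nonneg _) hR)
      (mul_le_mul (h₁ N hN a ha).1 (h₂ N hN a ha).2 (norm_nonneg _) (by positivity))
  · rw [norm_mul]
    exact mul_le_mul (h₁ 1 le_rfl a ha).2 (h₂ 1 le_rfl a ha).2 (norm_nonneg _) hC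

theorem const_mul (c : ℂ) (h : UniformRate S f g) :
    UniformRate S (fun N a => c * f N a) (fun a => c * g a) :=
  (const_right (g := fun _ => c) (D := ‖c‖) (fun _ _ => le_rfl)).mul h

theorem sub (h₁ : UniformRate S f₁ g₁) (h₂ : UniformRate S f₂ g₂) :
    UniformRate S (fun N a => f₁ N a - f₂ N a) (fun a => g₁ a - g₂ a) :=
  (h₁.add (h₂.const_mul (-1))).congr (fun _ _ _ _ => by ring) (fun _ _ => by ring)

end UniformRate

/-- Entire functions `Φ N` converging to `Φ₀` at rate `1 / N`, uniformly on bounded sets. -/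
structure EntireRate (Φ : ℕ → ℂ → ℂ) (Φ₀ : ℂ → ℂ) : Prop where
  differentiable : ∀ N, Differentiable ℂ (Φ N)
  differentiable_limit : Differentiable ℂ Φ₀
  rate : ∀ R : ℝ, UniformRate (Metric.closedBall 0 R) Φ Φ₀

theorem norm_deriv_le_of_norm_le_closedBall {f : ℂ → ℂ} (hf : Differentiable ℂ f) {R C : ℝ}
    (h : ∀ z ∈ Metric.closedBall (0 : ℂ) (R + 1), ‖f z‖ ≤ C) {z : ℂ}
    (hz : z ∈ Metric.closedBall (0 : ℂ) R) : ‖deriv f z‖ ≤ C := by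
  have := Complex.norm_deriv_le_of_forall_mem_sphere_norm_le (c := z) (C := C) one_pos
    hf.diffContOnCl (fun w hw => h w ?_)
  · simpa using this
  · rw [mem_closedBall_zero_iff] at hz ⊢
    have h1 : ‖w - z‖ = 1 := by simpa [dist_eq_norm] using hw
    have h2 := norm_add_le (w - z) z
    rw [sub_add_cancel] at h2
    linarith

namespace EntireRate

variable {Φ : ℕ → ℂ → ℂ} {Φ₀ : ℂ → ℂ}

theorem of_entire (h : Differentiable ℂ Φ₀) : EntireRate (fun _ => Φ₀) Φ₀ := by
  refine ⟨fun _ => h, h, fun R => ?_⟩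
  obtain ⟨D, hD⟩ := (isCompact_closedBall (0 : ℂ) R).exists_bound_of_continuousOn
    h.continuous.continuousOn
  exact UniformRate.const_right hD

theorem deriv (h : EntireRate Φ Φ₀) :
    EntireRate (fun N => _root_.deriv (Φ N)) (_root_.deriv Φ₀) := by
  refine ⟨fun N => (h.differentiable N).deriv, h.differentiable_limit.deriv, fun R => ?_⟩
  obtain ⟨C, hC, hb⟩ := h.rate (R + 1)
  refine UniformRate.of_bound (C := C) (D := C) (fun N hN z hz => ?_) (fun z hz => ?_)
  · rw [← deriv_sub (h.differentiable N z) (h.differentiable_limit z)]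
    exact norm_deriv_le_of_norm_le_closedBall ((h.differentiable N).sub h.differentiable_limit)
      (fun w hw => (hb N hN w hw).1) hz
  · exact norm_deriv_le_of_norm_le_closedBall h.differentiable_limit
      (fun w hw => (hb 1 le_rfl w hw).2) hz

theorem comp_uniformRate (h : EntireRate Φ Φ₀) {α : Type*} {S : Set α} {f : ℕ → α → ℂ} {g : α → ℂ}
    (hf : UniformRate S f g) :
    UniformRate S (fun N a => Φ N (f N a)) (fun a => Φ₀ (g a)) := by
  obtain ⟨R, -, hR⟩ := hf.norm_le
  obtain ⟨C, hC, hb⟩ := hf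
  obtain ⟨D, hD, hΦ⟩ := h.rate R
  obtain ⟨E, hE, hΦ'⟩ := h.deriv.rate R
  refine UniformRate.of_bound (C := D + E * C) (D := D) (fun N hN a ha => ?_) (fun a ha => ?_)
  · have hfm : f N a ∈ Metric.closedBall (0 : ℂ) R := by simpa using (hR N hN a ha).1
    have hgm : g a ∈ Metric.closedBall (0 : ℂ) R := by simpa using (hR N hN a ha).2
    have h1 := (hΦ N hN _ hfm).1
    have h2 := Convex.norm_image_sub_le_of_norm_deriv_le (𝕜 := ℂ)
      (fun z _ => h.differentiable_limit z) (fun z hz => (hΦ' N hN z hz).2)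
      (convex_closedBall (0 : ℂ) R) hgm hfm
    have h3 := mul_le_mul_of_nonneg_left (hb N hN a ha).1 hE
    calc ‖Φ N (f N a) - Φ₀ (g a)‖
        = ‖(Φ N (f N a) - Φ₀ (f N a)) + (Φ₀ (f N a) - Φ₀ (g a))‖ := by congr 1; ring
      _ ≤ D / N + E * (C / N) := (norm_add_le _ _).trans (add_le_add h1 (h2.trans h3))
      _ = (D + E * C) / N := by ring
  · exact (hΦ 1 le_rfl _ (by simpa using (hR 1 le_rfl a ha).2)).2

end EntireRate

/-- `f N` converges to `g` at rate `1 / N` in `C¹([0, U])`. -/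
structure C1Rate (U : ℝ) (f : ℕ → ℝ → ℂ) (g : ℝ → ℂ) : Prop where
  differentiable : ∀ N, Differentiable ℝ (f N)
  differentiable_limit : Differentiable ℝ g
  rate : UniformRate (Icc 0 U) f g
  rate_deriv : UniformRate (Icc 0 U) (fun N => deriv (f N)) (deriv g)

namespace C1Rate

variable {U : ℝ} {f f₁ f₂ : ℕ → ℝ → ℂ} {g g₁ g₂ : ℝ → ℂ}

theorem const (c : ℂ) : C1Rate U (fun _ _ => c) (fun _ => c) :=
  ⟨fun _ => differentiable_const c, differentiable_const c,
    UniformRate.const_right (D := ‖c‖) fun _ _ => le_rfl,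
    UniformRate.const_right (D := 0) fun _ _ => by simp⟩

theorem add (h₁ : C1Rate U f₁ g₁) (h₂ : C1Rate U f₂ g₂) :
    C1Rate U (fun N u => f₁ N u + f₂ N u) (fun u => g₁ u + g₂ u) :=
  ⟨fun N => (h₁.differentiable N).add (h₂.differentiable N),
    h₁.differentiable_limit.add h₂.differentiable_limit, h₁.rate.add h₂.rate,
    (h₁.rate_deriv.add h₂.rate_deriv).congr
      (fun N _ u _ => deriv_fun_add (h₁.differentiable N u) (h₂.differentiable N u))
      (fun u _ => deriv_fun_add (h₁.differentiable_limit u) (h₂.differentiable_limit u))⟩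

theorem mul (h₁ : C1Rate U f₁ g₁) (h₂ : C1Rate U f₂ g₂) :
    C1Rate U (fun N u => f₁ N u * f₂ N u) (fun u => g₁ u * g₂ u) :=
  ⟨fun N => (h₁.differentiable N).mul (h₂.differentiable N),
    h₁.differentiable_limit.mul h₂.differentiable_limit, h₁.rate.mul h₂.rate,
    ((h₁.rate_deriv.mul h₂.rate).add (h₁.rate.mul h₂.rate_deriv)).congr
      (fun N _ u _ => deriv_fun_mul (h₁.differentiable N u) (h₂.differentiable N u))
      (fun u _ => deriv_fun_mul (h₁.differentiable_limit u) (h₂.differentiable_limit u))⟩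

theorem comp_entire (h : C1Rate U f g) {Φ : ℕ → ℂ → ℂ} {Φ₀ : ℂ → ℂ} (hΦ : EntireRate Φ Φ₀) :
    C1Rate U (fun N u => Φ N (f N u)) (fun u => Φ₀ (g u)) := by
  have key : ∀ {F : ℂ → ℂ} {k : ℝ → ℂ}, Differentiable ℂ F → Differentiable ℝ k → ∀ u : ℝ,
      HasDerivAt (fun u => F (k u)) (deriv F (k u) * deriv k u) u := fun hF hk u => by
    have := (hF _).hasDerivAt.scomp u (hk u).hasDerivAt
    rwa [smul_eq_mul, mul_comm] at this
  exact ⟨fun N u => (key (hΦ.differentiable N) (h.differentiable N) u).differentiableAt,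
    fun u => (key hΦ.differentiable_limit h.differentiable_limit u).differentiableAt,
    hΦ.comp_uniformRate h.rate,
    ((hΦ.deriv.comp_uniformRate h.rate).mul h.rate_deriv).congr
      (fun N _ u _ => (key (hΦ.differentiable N) (h.differentiable N) u).deriv)
      (fun u _ => (key hΦ.differentiable_limit h.differentiable_limit u).deriv)⟩

/-- Functions that agree at `0` and whose derivatives converge at rate `1 / N`. -/
theorem of_deriv {f' : ℕ → ℝ → ℂ} {g' : ℝ → ℂ} (hf : ∀ N u, HasDerivAt (f N) (f' N u) u)
    (hg : ∀ u, HasDerivAt g (g' u) u) (h0 : ∀ N, f N 0 = g 0) (hg' : Continuous g')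
    {C : ℝ} (h : ∀ N : ℕ, 1 ≤ N → ∀ u ∈ Icc 0 U, ‖f' N u - g' u‖ ≤ C / N) :
    C1Rate U f g := by
  have hgc : Continuous g := continuous_iff_continuousAt.2 fun u => (hg u).continuousAt
  obtain ⟨D, hD⟩ := isCompact_Icc.exists_bound_of_continuousOn (s := Icc 0 U) hgc.continuousOn
  obtain ⟨E, hE⟩ := isCompact_Icc.exists_bound_of_continuousOn (s := Icc 0 U) hg'.continuousOn
  refine ⟨fun N u => (hf N u).differentiableAt, fun u => (hg u).differentiableAt,
    UniformRate.of_bound (C := C * U) (D := D) (fun N hN u hu => ?_) hD,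
    (UniformRate.of_bound (C := C) (D := E) h hE).congr (fun N _ u _ => (hf N u).deriv)
      (fun u _ => (hg u).deriv)⟩
  have h1 := (convex_Icc 0 U).norm_image_sub_le_of_norm_hasDerivWithin_le
    (f := fun u => f N u - g u) (fun v _ => ((hf N v).sub (hg v)).hasDerivWithinAt)
    (fun v hv => h N hN v hv) (left_mem_Icc.2 (hu.1.trans hu.2)) hu
  simp only [h0, sub_self, sub_zero] at h1
  have hC : 0 ≤ C / N := (norm_nonneg _).trans (h N hN u hu)
  calc _ ≤ C / N * ‖u‖ := h1
    _ ≤ C / N * U := by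
      rw [Real.norm_of_nonneg hu.1]
      exact mul_le_mul_of_nonneg_left hu.2 hC
    _ = C * U / N := by ring

theorem dslope (h : C1Rate U f g) :
    UniformRate (Icc 0 U ×ˢ Icc 0 U) (fun N p => _root_.dslope (f N) p.1 p.2)
      (fun p => _root_.dslope g p.1 p.2) := by
  have bound : ∀ {k : ℝ → ℂ} {C : ℝ}, Differentiable ℝ k → (∀ u ∈ Icc 0 U, ‖deriv k u‖ ≤ C) →
      ∀ p ∈ Icc 0 U ×ˢ Icc 0 U, ‖_root_.dslope k p.1 p.2‖ ≤ C := by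
    rintro k C hk hC ⟨u, v⟩ ⟨hu, hv⟩
    rcases eq_or_ne v u with rfl | hne
    · simpa using hC v hv
    · have h1 := (convex_Icc 0 U).norm_image_sub_le_of_norm_deriv_le (fun w _ => hk w) hC hu hv
      rw [dslope_of_ne _ hne, slope_def_module, norm_smul, norm_inv, inv_mul_le_iff₀
        (norm_pos_iff.2 (sub_ne_zero.2 hne)), mul_comm]
      exact h1
  have dslope_sub : ∀ {k l : ℝ → ℂ}, Differentiable ℝ k → Differentiable ℝ l → ∀ u v,
      _root_.dslope k u v - _root_.dslope l u v = _root_.dslope (fun w => k w - l w) u v := by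
    intro k l hk hl u v
    rcases eq_or_ne v u with rfl | hne
    · simp [deriv_fun_sub (hk v) (hl v)]
    · rw [dslope_of_ne _ hne, dslope_of_ne _ hne, dslope_of_ne _ hne, slope_def_module,
        slope_def_module, slope_def_module, ← smul_sub]
      congr 1
      ring
  obtain ⟨C, hC, h'⟩ := h.rate_deriv
  refine UniformRate.of_bound (C := C) (D := C) (fun N hN p hp => ?_)
    (bound h.differentiable_limit fun u hu => (h' 1 le_rfl u hu).2)
  rw [dslope_sub (h.differentiable N) h.differentiable_limit]
  refine bound ((h.differentiable N).sub h.differentiable_limit) (fun u hu => ?_) p hp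
  rw [deriv_sub (h.differentiable N u) (h.differentiable_limit u)]
  exact (h' N hN u hu).1

end C1Rate

/-! ### Hypergeometric series -/

theorem poch_succ (x : ℂ) (k : ℕ) : poch x (k + 1) = poch x k * (x + k) :=
  Finset.prod_range_succ _ _

theorem poch_neg_natCast (m k : ℕ) : poch (-(m : ℂ)) k = (-1) ^ k * (m.descFactorial k : ℂ) := by
  induction k with
  | zero => simp [poch]
  | succ k ih =>
    rw [poch_succ, ih, Nat.descFactorial_succ, pow_succ]
    rcases le_or_gt k m with h | h
    · push_cast [h]
      ring
    · simp [Nat.descFactorial_of_lt h]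

theorem norm_poch_div_le (b : ℂ) {c : ℝ} (hc : 0 < c) (k : ℕ) :
    ‖poch b k / poch (c : ℂ) k‖ ≤ (‖b‖ / c + 1) ^ k := by
  unfold poch
  rw [← Finset.prod_div_distrib, norm_prod]
  refine (Finset.prod_le_prod (fun _ _ => norm_nonneg _) (fun i _ => ?_)).trans_eq
    (by rw [Finset.prod_const, Finset.card_range])
  have h1 : ‖(c : ℂ) + i‖ = c + i := by
    rw [← Complex.ofReal_natCast, ← Complex.ofReal_add, Complex.norm_real,
      Real.norm_of_nonneg (by positivity)]
  rw [norm_div, h1, div_le_iff₀ (by positivity)]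
  have h2 : ‖b + i‖ ≤ ‖b‖ + i := (norm_add_le _ _).trans_eq (by simp)
  have h3 : ‖b‖ / c * c = ‖b‖ := div_mul_cancel₀ _ hc.ne'
  have h4 : 0 ≤ ‖b‖ / c * i := by positivity
  nlinarith

/-- The coefficients of `₁F₁[b, c; z]`. -/
def hypCoeff (b c : ℂ) (k : ℕ) : ℂ := poch b k / (poch c k * k.factorial)

theorem norm_hypCoeff_le (b : ℂ) {c : ℝ} (hc : 0 < c) (k : ℕ) :
    ‖hypCoeff b c k‖ ≤ (‖b‖ / c + 1) ^ k / k.factorial := by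
  rw [hypCoeff, ← div_div, norm_div, Complex.norm_natCast]
  gcongr
  exact norm_poch_div_le b hc k

/-- The polynomial `₂F₁[-m, b, c; -z / N]`. -/
def scaledGauss (m N : ℕ) (b c z : ℂ) : ℂ :=
  ∑ k ∈ Finset.range (m + 1),
    hypCoeff b c k * (((m.descFactorial k : ℝ) / (N : ℝ) ^ k : ℝ) : ℂ) * z ^ k

theorem twoF1neg_neg_div {m N : ℕ} (hN : N ≠ 0) (b c z : ℂ) :
    twoF1neg m b c (-z / N) = scaledGauss m N b c z := by
  refine Finset.sum_congr rfl fun k _ => ?_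
  have hN' : (N : ℂ) ≠ 0 := by exact_mod_cast hN
  rw [poch_neg_natCast, hypCoeff, div_pow, neg_pow]
  push_cast
  have : ((-1 : ℂ) ^ k) * (-1) ^ k = 1 := by rw [← mul_pow]; simp
  calc _ = ((-1 : ℂ) ^ k * (-1) ^ k) * ((m.descFactorial k : ℂ) * poch b k /
        (poch c k * k.factorial) * (z ^ k / N ^ k)) := by ring
    _ = _ := by rw [this]; ring

theorem abs_descFactorial_div_pow_sub_one_le {m N : ℕ} (hN : 1 ≤ N) (h₁ : m ≤ N) (h₂ : N ≤ m + 1)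
    (k : ℕ) : |(m.descFactorial k : ℝ) / (N : ℝ) ^ k - 1| ≤ 2 ^ k / N := by
  have hN' : (0 : ℝ) < N := by exact_mod_cast hN
  have h₂' : (N : ℝ) ≤ m + 1 := by exact_mod_cast h₂
  have h₁' : (m : ℝ) ≤ N := by exact_mod_cast h₁
  have key : (m.descFactorial k : ℝ) / (N : ℝ) ^ k ≤ 1 ∧
      1 - (m.descFactorial k : ℝ) / (N : ℝ) ^ k ≤ 2 ^ k / N := by
    induction k with
    | zero => simp
    | succ k ih =>
      obtain ⟨ih₁, ih₂⟩ := ih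
      have hd : 0 ≤ (m.descFactorial k : ℝ) / (N : ℝ) ^ k := by positivity
      have hk : (k : ℝ) + 1 ≤ 2 ^ k := by exact_mod_cast Nat.lt_two_pow_self
      have hpow : (2 : ℝ) ^ (k + 1) / N = 2 ^ k / N + 2 ^ k / N := by ring
      have h2k : ((k : ℝ) + 1) / N ≤ 2 ^ k / N := by gcongr
      rcases le_or_gt k m with h | h
      · have e : (m.descFactorial (k + 1) : ℝ) / (N : ℝ) ^ (k + 1) =
            (m.descFactorial k : ℝ) / (N : ℝ) ^ k * ((m - k) / N) := by
          rw [Nat.descFactorial_succ, pow_succ]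
          push_cast [h]
          field_simp
        have hkm : (k : ℝ) ≤ m := by exact_mod_cast h
        have q0 : 0 ≤ ((m : ℝ) - k) / N := div_nonneg (by linarith) hN'.le
        have q1 : ((m : ℝ) - k) / N ≤ 1 := by
          rw [div_le_one hN']
          linarith [(Nat.cast_nonneg k : (0 : ℝ) ≤ k)]
        have q2 : 1 - ((m : ℝ) - k) / N ≤ (k + 1) / N := by
          rw [sub_le_iff_le_add, ← add_div, le_div_iff₀ hN']
          linarith
        rw [e, hpow]
        refine ⟨mul_le_one₀ ih₁ q0 q1, ?_⟩
        nlinarith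
      · have e1 : m.descFactorial k = 0 := Nat.descFactorial_of_lt h
        have e2 : m.descFactorial (k + 1) = 0 := Nat.descFactorial_of_lt (by omega)
        rw [e1] at ih₂
        rw [e2, hpow]
        have : (0 : ℝ) ≤ 2 ^ k / N := by positivity
        simp only [Nat.cast_zero, zero_div] at ih₂ ⊢
        exact ⟨zero_le_one, by linarith⟩
  rw [abs_sub_comm, abs_of_nonneg (by linarith [key.1])]
  exact key.2

theorem norm_hypCoeff_mul_pow_le (b : ℂ) {c : ℝ} (hc : 0 < c) {R : ℝ} {z : ℂ} (hz : ‖z‖ ≤ R)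
    (k : ℕ) : ‖hypCoeff b c k * z ^ k‖ ≤ ((‖b‖ / c + 1) * R) ^ k / k.factorial := by
  rw [norm_mul, norm_pow, mul_pow, mul_div_right_comm]
  exact mul_le_mul (norm_hypCoeff_le b hc k) (pow_le_pow_left₀ (norm_nonneg _) hz k)
    (by positivity) (by positivity)

theorem differentiable_oneF1 (b : ℂ) {c : ℝ} (hc : 0 < c) :
    Differentiable ℂ (oneF1 b c) := by
  intro z
  have h := differentiableOn_tsum_of_summable_norm
    (F := fun (k : ℕ) (w : ℂ) => hypCoeff b c k * w ^ k) (U := Metric.ball 0 (‖z‖ + 1))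
    (Real.summable_pow_div_factorial ((‖b‖ / c + 1) * (‖z‖ + 1)))
    (fun k => by fun_prop) Metric.isOpen_ball
    (fun k w hw => norm_hypCoeff_mul_pow_le b hc (by simpa using (mem_ball_zero_iff.1 hw).le) k)
  exact h.differentiableAt (Metric.isOpen_ball.mem_nhds (by simp))

theorem entireRate_scaledGauss (b : ℂ) {c : ℝ} (hc : 0 < c) {m : ℕ → ℕ} (h₁ : ∀ N, m N ≤ N)
    (h₂ : ∀ N, N ≤ m N + 1) :
    EntireRate (fun N => scaledGauss (m N) N b c) (oneF1 b c) := by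
  refine ⟨fun N => ?_, differentiable_oneF1 b hc, fun R => ?_⟩
  · unfold scaledGauss
    fun_prop
  obtain ⟨D, hD⟩ := (isCompact_closedBall (0 : ℂ) R).exists_bound_of_continuousOn
    (differentiable_oneF1 b hc).continuous.continuousOn
  refine UniformRate.of_bound
    (C := ∑' k : ℕ, (2 * ((‖b‖ / c + 1) * R)) ^ k / k.factorial) (D := D)
    (fun N hN z hz => ?_) hD
  rw [mem_closedBall_zero_iff] at hz
  have hs : Summable fun k : ℕ => hypCoeff b c k * z ^ k :=
    .of_norm_bounded (Real.summable_pow_div_factorial _) (norm_hypCoeff_mul_pow_le b hc hz)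
  have hg : HasSum (fun k : ℕ =>
      hypCoeff b c k * ((((m N).descFactorial k : ℝ) / (N : ℝ) ^ k : ℝ) : ℂ) * z ^ k)
      (scaledGauss (m N) N b c z) := by
    refine hasSum_sum_of_ne_finset_zero fun k hk => ?_
    rw [Nat.descFactorial_of_lt (by simpa using hk)]
    simp
  rw [← tsum_div_const]
  refine (hg.sub hs.hasSum).norm_le_of_bounded
    ((Real.summable_pow_div_factorial _).div_const _).hasSum fun k => ?_
  have e : hypCoeff b c k * ((((m N).descFactorial k : ℝ) / (N : ℝ) ^ k : ℝ) : ℂ) * z ^ k -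
      hypCoeff b c k * z ^ k =
      ((((m N).descFactorial k : ℝ) / (N : ℝ) ^ k - 1 : ℝ) : ℂ) * (hypCoeff b c k * z ^ k) := by
    push_cast
    ring
  rw [e, norm_mul, Complex.norm_real, Real.norm_eq_abs]
  refine (mul_le_mul (abs_descFactorial_div_pow_sub_one_le hN (h₁ N) (h₂ N) k)
    (norm_hypCoeff_mul_pow_le b hc hz k) (norm_nonneg _) (by positivity)).trans_eq ?_
  rw [mul_pow 2]
  ring

/-! ### Elementary families -/

theorem one_le_norm_one_sub_I_mul (w : ℝ) : 1 ≤ ‖1 - I * (w : ℂ)‖ := by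
  have := Complex.abs_re_le_norm (1 - I * (w : ℂ))
  simpa using this

theorem one_sub_I_mul_ne_zero (w : ℝ) : 1 - I * (w : ℂ) ≠ 0 :=
  norm_pos_iff.1 (one_pos.trans_le (one_le_norm_one_sub_I_mul w))

theorem div_natCast_bounds {U u : ℝ} (hu : u ∈ Icc 0 U) {N : ℕ} (hN : 1 ≤ N) :
    0 ≤ u / N ∧ u / N ≤ U ∧ u / N ≤ U / N ∧ (u / N) ^ 2 ≤ U ^ 2 / N := by
  have hN' : (1 : ℝ) ≤ N := by exact_mod_cast hN
  have h0 : 0 ≤ u / N := div_nonneg hu.1 (by positivity)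
  have h1 : u / N ≤ u := div_le_self hu.1 hN'
  have h2 : u / N ≤ U / N := by gcongr; exact hu.2
  have h3 : u / N ≤ U := h1.trans hu.2
  refine ⟨h0, h3, h2, ?_⟩
  calc (u / N) ^ 2 = u / N * (u / N) := sq _
    _ ≤ U * (U / N) := mul_le_mul h3 h2 h0 (h0.trans h3)
    _ = U ^ 2 / N := by ring

theorem c1Rate_moebius (U : ℝ) :
    C1Rate U (fun N u => 2 * I * (u : ℂ) / (1 - I * ((u / N : ℝ) : ℂ))) (fun u => 2 * I * u) := by
  refine C1Rate.of_deriv (f' := fun N u => 2 * I / (1 - I * ((u / N : ℝ) : ℂ)) ^ 2)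
    (g' := fun _ => 2 * I) (C := 2 * (2 * U + U ^ 2)) (fun N u => ?_) (fun u => ?_)
    (fun N => by simp) continuous_const (fun N hN u hu => ?_)
  · have h1 : HasDerivAt (fun u : ℝ => 2 * I * (u : ℂ)) (2 * I * ((1 : ℝ) : ℂ)) u :=
      (hasDerivAt_id u).ofReal_comp.const_mul (2 * I)
    have h2 : HasDerivAt (fun u : ℝ => 1 - I * ((u / N : ℝ) : ℂ))
        (-(I * ((1 / N : ℝ) : ℂ))) u :=
      (((hasDerivAt_id u).div_const (N : ℝ)).ofReal_comp.const_mul I).const_sub 1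
    refine (h1.fun_div h2 (one_sub_I_mul_ne_zero _)).congr_deriv ?_
    congr 1
    push_cast
    ring
  · simpa using (hasDerivAt_id u).ofReal_comp.const_mul (2 * I)
  · obtain ⟨h0, h1, h2, h3⟩ := div_natCast_bounds hu hN
    set w : ℝ := u / N with hw
    have hne := one_sub_I_mul_ne_zero w
    have e : 2 * I / (1 - I * (w : ℂ)) ^ 2 - 2 * I =
        2 * I * (2 * I * w + (w : ℂ) ^ 2) / (1 - I * (w : ℂ)) ^ 2 := by
      rw [div_sub' (pow_ne_zero 2 hne)]
      congr 1
      ring_nf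
      simp only [Complex.I_sq, Complex.I_pow_three]
      ring
    rw [e, norm_div, norm_pow]
    refine (div_le_self (norm_nonneg _) (one_le_pow₀ (one_le_norm_one_sub_I_mul w))).trans ?_
    have h4 : ‖2 * I * (w : ℂ) + (w : ℂ) ^ 2‖ ≤ 2 * w + w ^ 2 :=
      (norm_add_le _ _).trans_eq (by simp [abs_of_nonneg h0])
    have h5 : ‖2 * I‖ = 2 := by simp
    rw [norm_mul, h5]
    calc 2 * ‖2 * I * (w : ℂ) + (w : ℂ) ^ 2‖ ≤ 2 * (2 * (U / N) + U ^ 2 / N) := by linarith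
      _ = 2 * (2 * U + U ^ 2) / N := by ring

theorem one_div_one_add_sq_le_one (w : ℝ) : 1 / (1 + w ^ 2) ≤ 1 :=
  (div_le_one (by positivity)).2 (by nlinarith [sq_nonneg w])

theorem c1Rate_natCast_mul_arctan (U : ℝ) :
    C1Rate U (fun N u => ((N * Real.arctan (u / N) : ℝ) : ℂ)) (fun u => (u : ℂ)) := by
  refine C1Rate.of_deriv
    (f' := fun N u => ((N * (1 / (1 + (u / N) ^ 2) * (1 / N)) : ℝ) : ℂ))
    (g' := fun _ => ((1 : ℝ) : ℂ)) (C := U ^ 2)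
    (fun N u => (((hasDerivAt_id u).div_const (N : ℝ)).arctan.const_mul (N : ℝ)).ofReal_comp)
    (fun u => (hasDerivAt_id u).ofReal_comp) (fun N => by simp) continuous_const
    (fun N hN u hu => ?_)
  have hN' : (N : ℝ) ≠ 0 := by positivity
  obtain ⟨-, -, -, h3⟩ := div_natCast_bounds hu hN
  rw [← Complex.ofReal_sub, Complex.norm_real, Real.norm_eq_abs]
  have e : N * (1 / (1 + (u / N) ^ 2) * (1 / N)) - 1 = -((u / N) ^ 2 / (1 + (u / N) ^ 2)) := by
    have : 1 + (u / N) ^ 2 ≠ 0 := by positivity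
    generalize u / N = w at *
    field_simp
    ring
  rw [e, abs_neg, abs_of_nonneg (by positivity)]
  exact (div_le_self (by positivity) (by nlinarith [sq_nonneg (u / N)])).trans h3

theorem c1Rate_arctan (U : ℝ) :
    C1Rate U (fun N u => ((Real.arctan (u / N) : ℝ) : ℂ)) (fun _ => 0) := by
  refine C1Rate.of_deriv (f' := fun N u => ((1 / (1 + (u / N) ^ 2) * (1 / N) : ℝ) : ℂ))
    (g' := fun _ => 0) (C := 1)
    (fun N u => ((hasDerivAt_id u).div_const (N : ℝ)).arctan.ofReal_comp)
    (fun u => hasDerivAt_const u 0) (fun N => by simp) continuous_const (fun N hN u hu => ?_)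
  rw [sub_zero, Complex.norm_real, Real.norm_of_nonneg (by positivity)]
  exact mul_le_of_le_one_left (by positivity) (one_div_one_add_sq_le_one _)

theorem c1Rate_log_one_add_sq (U : ℝ) :
    C1Rate U (fun N u => ((Real.log (1 + (u / N) ^ 2) : ℝ) : ℂ)) (fun _ => 0) := by
  refine C1Rate.of_deriv
    (f' := fun N u => ((2 * (u / N) * (1 / N) / (1 + (u / N) ^ 2) : ℝ) : ℂ))
    (g' := fun _ => 0) (C := 2 * U) (fun N u => ?_)
    (fun u => hasDerivAt_const u 0) (fun N => by simp) continuous_const (fun N hN u hu => ?_)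
  · have h : HasDerivAt (fun u : ℝ => 1 + (u / N) ^ 2) (2 * (u / N) * (1 / N)) u := by
      simpa using (((hasDerivAt_id u).div_const (N : ℝ)).fun_pow 2).const_add 1
    exact (h.log (by positivity)).ofReal_comp
  · obtain ⟨h0, h1, -, -⟩ := div_natCast_bounds hu hN
    rw [sub_zero, Complex.norm_real, Real.norm_of_nonneg (by positivity)]
    refine (div_le_self (by positivity) (by nlinarith [sq_nonneg (u / N)])).trans ?_
    rw [mul_one_div]
    gcongr

theorem c1Rate_id (U : ℝ) : C1Rate U (fun _ u => (u : ℂ)) (fun u => (u : ℂ)) :=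
  C1Rate.of_deriv (C := 0) (f' := fun _ _ => ((1 : ℝ) : ℂ)) (g' := fun _ => ((1 : ℝ) : ℂ))
    (fun _ u => (hasDerivAt_id u).ofReal_comp) (fun u => (hasDerivAt_id u).ofReal_comp)
    (fun _ => rfl) continuous_const (fun _ _ _ _ => by simp)

/-! ### The weight -/

theorem one_sub_I_mul_eq_exp (w : ℝ) :
    1 - I * (w : ℂ) =
      Complex.exp (((Real.log (1 + w ^ 2) / 2 : ℝ) : ℂ) - I * (Real.arctan w : ℂ)) := by
  have h : (0 : ℝ) < 1 + w ^ 2 := by positivity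
  have hs : √(1 + w ^ 2) ≠ 0 := (Real.sqrt_pos.2 h).ne'
  have e : Real.exp (Real.log (1 + w ^ 2) / 2) = √(1 + w ^ 2) := by
    rw [← Real.log_sqrt h.le, Real.exp_log (Real.sqrt_pos.2 h)]
  rw [sub_eq_add_neg (((Real.log (1 + w ^ 2) / 2 : ℝ) : ℂ)), Complex.exp_add,
    ← Complex.ofReal_exp, e,
    show -(I * (Real.arctan w : ℂ)) = ((-Real.arctan w : ℝ) : ℂ) * I by push_cast; ring,
    Complex.exp_mul_I, ← Complex.ofReal_cos, ← Complex.ofReal_sin, Real.cos_neg, Real.sin_neg,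
    Real.cos_arctan, Real.sin_arctan]
  have hs' : ((√(1 + w ^ 2) : ℝ) : ℂ) ≠ 0 := by exact_mod_cast hs
  push_cast
  field_simp
  ring

theorem arg_one_add_I_mul (x : ℝ) : Complex.arg (1 + I * x) = Real.arctan x := by
  have h : (1 + I * (x : ℂ)) = Complex.exp (((Real.log (1 + x ^ 2) / 2 : ℝ) : ℂ) +
      (Real.arctan x : ℂ) * I) := by
    have := one_sub_I_mul_eq_exp (-x)
    simp only [Real.arctan_neg, neg_sq, Complex.ofReal_neg, mul_neg, sub_neg_eq_add] at this
    rw [this, mul_comm I]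
  rw [h, Complex.exp_add, ← Complex.ofReal_exp, Complex.exp_mul_I]
  exact Complex.arg_mul_cos_add_sin_mul_I (Real.exp_pos _)
    ⟨by linarith [Real.neg_pi_div_two_lt_arctan x, Real.pi_pos],
      by linarith [Real.arctan_lt_pi_div_two x, Real.pi_pos]⟩

/-- The phase and radial correction of `(x - i)^(N - j) √(w_H(x))` at `x = N / u`, with
`ρ = Re(s) + j`. -/
def weightExponent (s : ℂ) (j : ℂ) (N : ℕ) (u : ℝ) : ℂ :=
  -I * (((N * Real.arctan (u / N) : ℝ) : ℂ) + -j * ((Real.arctan (u / N) : ℝ) : ℂ)) +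
    (-(s.re + j) / 2 * ((Real.log (1 + (u / N) ^ 2) : ℝ) : ℂ) +
      ((s.im * (Real.pi / 2) : ℂ) + -(s.im : ℂ) * ((Real.arctan (u / N) : ℝ) : ℂ)))

theorem c1Rate_weightExponent (s j : ℂ) (U : ℝ) :
    C1Rate U (weightExponent s j) (fun u => -I * u + s.im * (Real.pi / 2)) := by
  have h := ((C1Rate.const (-I)).mul ((c1Rate_natCast_mul_arctan U).add
    ((C1Rate.const (-j)).mul (c1Rate_arctan U)))).add
    (((C1Rate.const (-(s.re + j) / 2)).mul (c1Rate_log_one_add_sq U)).add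
      ((C1Rate.const (s.im * (Real.pi / 2) : ℂ)).add
        ((C1Rate.const (-(s.im : ℂ))).mul (c1Rate_arctan U))))
  simp only [mul_zero, add_zero, zero_add] at h
  exact h

theorem pow_mul_sqrt_wH (s : ℂ) {N j m : ℕ} (hm : m + j = N) (hN : N ≠ 0) {u : ℝ} (hu : 0 < u) :
    ((N / u : ℝ) - I : ℂ) ^ m * (√(wH s N (N / u)) : ℂ) =
      (((u / N) ^ (s.re + j) : ℝ) : ℂ) * Complex.exp (weightExponent s j N u) := by
  have hN' : (0 : ℝ) < N := by positivity
  set w : ℝ := u / N with hw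
  have hw0 : 0 < w := by positivity
  have hNu : (N / u : ℝ) = w⁻¹ := by rw [hw, inv_div]
  have h1 : ((w⁻¹ : ℝ) - I : ℂ) = Complex.exp (-(Real.log w : ℂ) +
      (((Real.log (1 + w ^ 2) / 2 : ℝ) : ℂ) - I * (Real.arctan w : ℂ))) := by
    rw [Complex.exp_add, ← one_sub_I_mul_eq_exp, Complex.exp_neg, ← Complex.ofReal_exp,
      Real.exp_log hw0]
    have : (w : ℂ) ≠ 0 := by exact_mod_cast hw0.ne'
    push_cast
    field_simp
  have h2 : √(wH s N w⁻¹) = Real.exp ((-s.re - N) / 2 * (Real.log (1 + w ^ 2) - 2 * Real.log w) +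
      s.im * (Real.pi / 2 - Real.arctan w)) := by
    have e : 1 + w⁻¹ ^ 2 = Real.exp (Real.log (1 + w ^ 2) - 2 * Real.log w) := by
      rw [Real.exp_sub, Real.exp_log (by positivity), two_mul, Real.exp_add, Real.exp_log hw0]
      field_simp
      ring
    rw [wH, arg_one_add_I_mul, Real.arctan_inv_of_pos hw0, e, ← Real.exp_mul, ← Real.exp_add,
      Real.sqrt_eq_rpow, ← Real.exp_mul]
    congr 1
    ring
  have h3 : w ^ (s.re + j) = Real.exp (Real.log w * (s.re + j)) := Real.rpow_def_of_pos hw0 _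
  rw [hNu, h1, h2, h3, weightExponent, ← hw, ← Complex.exp_nat_mul, Complex.ofReal_exp,
    Complex.ofReal_exp, ← Complex.exp_add, ← Complex.exp_add]
  congr 1
  have hmc : (m : ℂ) = N - j := by rw [← hm]; push_cast; ring
  rw [hmc]
  push_cast
  ring

theorem two_div_one_add_I_mul {N : ℕ} (hN : N ≠ 0) {u : ℝ} (hu : 0 < u) :
    2 / (1 + I * ((N / u : ℝ) : ℂ)) =
      -(2 * I * (u : ℂ) / (1 - I * ((u / N : ℝ) : ℂ))) / N := by
  have h1 := one_sub_I_mul_ne_zero (u / N)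
  have h2 := one_sub_I_mul_ne_zero (-(N / u))
  have hu' : (u : ℂ) ≠ 0 := by exact_mod_cast hu.ne'
  have hN' : (N : ℂ) ≠ 0 := by exact_mod_cast hN
  rw [Complex.ofReal_neg, mul_neg, sub_neg_eq_add] at h2
  rw [← neg_div, div_div, div_eq_div_iff h2 (mul_ne_zero h1 hN')]
  push_cast
  field_simp
  ring_nf
  simp only [Complex.I_sq]
  ring

/-- The regular factor of `x ↦ p(N x) √(w_H(N x))` in the variable `u = 1 / x`, for
`p = (x - i)^(N - j) ₂F₁[-(N - j), b, c; 2 / (1 + i x)]`. -/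
def regularPart (s : ℂ) (j : ℕ) (b : ℂ) (c : ℝ) (N : ℕ) (u : ℝ) : ℂ :=
  Complex.exp (weightExponent s j N u) *
    scaledGauss (N - j) N b c (2 * I * (u : ℂ) / (1 - I * ((u / N : ℝ) : ℂ)))

/-- The limit of `regularPart`. -/
def regularLimit (s : ℂ) (b : ℂ) (c : ℝ) (u : ℝ) : ℂ :=
  Complex.exp (-I * u + s.im * (Real.pi / 2)) * oneF1 b c (2 * I * u)

theorem c1Rate_regularPart (s : ℂ) {j : ℕ} (hj : j ≤ 1) (b : ℂ) {c : ℝ} (hc : 0 < c) (U : ℝ) :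
    C1Rate U (regularPart s j b c) (regularLimit s b c) :=
  ((c1Rate_weightExponent s j U).comp_entire (.of_entire Complex.differentiable_exp)).mul
    ((c1Rate_moebius U).comp_entire
      (entireRate_scaledGauss b hc (fun N => Nat.sub_le N j) (fun N => by omega)))

theorem phiN_natCast_mul (s : ℂ) {N : ℕ} (hN : 1 ≤ N) {x : ℝ} (hx : 0 < x) :
    phiN s N (N * x) = ((((N : ℝ) ^ s.re)⁻¹ : ℝ) : ℂ) * ((x ^ (-s.re) : ℝ) : ℂ) *
      regularPart s 0 s (2 * s.re + 1) N (1 / x) := by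
  have hN0 : N ≠ 0 := by omega
  have hu : 0 < 1 / x := by positivity
  have e : (N * x : ℝ) = N / (1 / x) := by field_simp
  have h := pow_mul_sqrt_wH s (j := 0) (add_zero N) hN0 hu
  have hp : (1 / x / N) ^ (s.re + (0 : ℕ)) = ((N : ℝ) ^ s.re)⁻¹ * x ^ (-s.re) := by
    rw [Nat.cast_zero, add_zero, Real.div_rpow hu.le (by positivity), one_div,
      Real.inv_rpow hx.le, Real.rpow_neg hx.le, div_eq_inv_mul]
  rw [hp] at h
  rw [phiN, pTil, e, two_div_one_add_I_mul hN0 hu, twoF1neg_neg_div hN0, mul_right_comm, h,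
    regularPart, Nat.sub_zero]
  push_cast
  ring

theorem psiN_natCast_mul (s : ℂ) {N : ℕ} (hN : 1 ≤ N) {x : ℝ} (hx : 0 < x) :
    psiN s N (N * x) = ((((N : ℝ) ^ (s.re + 1))⁻¹ : ℝ) : ℂ) * ((x ^ (-s.re) : ℝ) : ℂ) *
      (((1 / x : ℝ) : ℂ) * regularPart s 1 (s + 1) (2 * s.re + 2) N (1 / x)) := by
  have hN0 : N ≠ 0 := by omega
  have hu : 0 < 1 / x := by positivity
  have e : (N * x : ℝ) = N / (1 / x) := by field_simp
  have h := pow_mul_sqrt_wH s (j := 1) (Nat.sub_add_cancel hN) hN0 hu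
  have hp : (1 / x / N) ^ (s.re + (1 : ℕ)) =
      ((N : ℝ) ^ (s.re + 1))⁻¹ * x ^ (-s.re) * (1 / x) := by
    rw [Nat.cast_one, Real.div_rpow hu.le (by positivity), Real.rpow_add_one hu.ne', one_div,
      Real.inv_rpow hx.le, Real.rpow_neg hx.le, div_eq_inv_mul, mul_assoc]
  rw [hp] at h
  rw [psiN, pPrev, e, two_div_one_add_I_mul hN0 hu, twoF1neg_neg_div hN0, mul_right_comm, h,
    regularPart]
  push_cast
  ring

theorem prefac_of_pos (s : ℂ) {x : ℝ} (hx : 0 < x) :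
    prefac s x = (((2 : ℝ) ^ s.re : ℝ) : ℂ) * ((x ^ (-s.re) : ℝ) : ℂ) *
      Complex.exp (-I * ((1 / x : ℝ) : ℂ) + s.im * (Real.pi / 2)) := by
  rw [prefac, abs_of_pos (by positivity), Real.div_rpow zero_le_two hx.le, Real.sign_of_pos hx,
    Real.rpow_neg hx.le, div_eq_mul_inv, Complex.ofReal_mul]
  congr 2
  push_cast
  ring

theorem Ptilde_of_pos (s : ℂ) {x : ℝ} (hx : 0 < x) :
    Ptilde s x = (((2 : ℝ) ^ s.re : ℝ) : ℂ) * ((x ^ (-s.re) : ℝ) : ℂ) *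
      regularLimit s s (2 * s.re + 1) (1 / x) := by
  have e : 2 * I / (x : ℂ) = 2 * I * ((1 / x : ℝ) : ℂ) := by push_cast; ring
  rw [Ptilde, prefac_of_pos s hx, regularLimit, e, mul_assoc]

theorem Qfun_of_pos (s : ℂ) {x : ℝ} (hx : 0 < x) :
    Qfun s x = ((2 * (2 : ℝ) ^ s.re : ℝ) : ℂ) * ((x ^ (-s.re) : ℝ) : ℂ) *
      (((1 / x : ℝ) : ℂ) * regularLimit s (s + 1) (2 * s.re + 2) (1 / x)) := by
  have e : 2 * I / (x : ℂ) = 2 * I * ((1 / x : ℝ) : ℂ) := by push_cast; ring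
  rw [Qfun, prefac_of_pos s hx, regularLimit, e]
  push_cast
  ring

/-! ### Integrable kernels -/

/-- The kernel `(f(x) g(y) - g(x) f(y)) / (x - y)`, extended to the diagonal. -/
def integrableKernel (f g : ℝ → ℂ) (x y : ℝ) : ℂ :=
  if x = y then deriv f x * g x - deriv g x * f x else (f x * g y - g x * f y) / ((x : ℂ) - y)

/-- The kernel `(F(u) H(v) - H(u) F(v)) / (v - u)`, extended to the diagonal. -/
def wronskianKernel (F H : ℝ → ℂ) (p : ℝ × ℝ) : ℂ :=
  F p.1 * dslope H p.1 p.2 - H p.1 * dslope F p.1 p.2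

theorem C1Rate.wronskianKernel {U : ℝ} {F H : ℕ → ℝ → ℂ} {F₀ H₀ : ℝ → ℂ} (hF : C1Rate U F F₀)
    (hH : C1Rate U H H₀) :
    UniformRate (Icc 0 U ×ˢ Icc 0 U) (fun N => _root_.wronskianKernel (F N) (H N))
      (_root_.wronskianKernel F₀ H₀) :=
  ((hF.rate.comap Prod.fst fun _ hp => hp.1).mul hH.dslope).sub
    ((hH.rate.comap Prod.fst fun _ hp => hp.1).mul hF.dslope)

theorem integrableKernel_natCast_mul (f g : ℝ → ℂ) {N : ℝ} (hN : N ≠ 0) (x y : ℝ) :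
    N * integrableKernel f g (N * x) (N * y) =
      integrableKernel (fun t => f (N * t)) (fun t => g (N * t)) x y := by
  have hN' : (N : ℂ) ≠ 0 := by exact_mod_cast hN
  rcases eq_or_ne x y with rfl | h
  · simp only [integrableKernel, if_true, deriv_comp_mul_left, Complex.real_smul]
    ring
  · have h' : N * x ≠ N * y := fun e => h (mul_left_cancel₀ hN e)
    simp only [integrableKernel, if_neg h, if_neg h']
    rw [Complex.ofReal_mul, Complex.ofReal_mul, ← mul_sub, ← mul_div_assoc,
      mul_div_mul_left _ _ hN']

theorem integrableKernel_eq_wronskianKernel {f g F H : ℝ → ℂ} {α β : ℂ} {r : ℝ}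
    (hf : ∀ t, 0 < t → f t = α * ((t ^ (-r) : ℝ) : ℂ) * F (1 / t))
    (hg : ∀ t, 0 < t → g t = β * ((t ^ (-r) : ℝ) : ℂ) * H (1 / t))
    (hF : Differentiable ℝ F) (hH : Differentiable ℝ H) {x y : ℝ} (hx : 0 < x) (hy : 0 < y) :
    integrableKernel f g x y =
      α * β * ((((x * y) ^ (r + 1))⁻¹ : ℝ) : ℂ) * wronskianKernel F H (1 / x, 1 / y) := by
  have e : ((x * y) ^ (r + 1))⁻¹ = x ^ (-r) * y ^ (-r) * (x⁻¹ * y⁻¹) := by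
    rw [Real.rpow_add_one (by positivity), Real.mul_rpow hx.le hy.le, Real.rpow_neg hx.le,
      Real.rpow_neg hy.le, mul_inv, mul_inv, mul_inv]
  rw [e]
  rcases eq_or_ne x y with rfl | h
  · have hpow : HasDerivAt (fun t : ℝ => t ^ (-r)) (-r * x ^ (-r - 1)) x :=
      Real.hasDerivAt_rpow_const (Or.inl hx.ne')
    have hinv : HasDerivAt (fun t : ℝ => 1 / t) (-(x ^ 2)⁻¹) x := by
      simpa only [one_div] using hasDerivAt_inv hx.ne'
    have key : ∀ {k K : ℝ → ℂ} {γ : ℂ},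
        (∀ t, 0 < t → k t = γ * ((t ^ (-r) : ℝ) : ℂ) * K (1 / t)) → Differentiable ℝ K →
        deriv k x = γ * ((-r * x ^ (-r - 1) : ℝ) : ℂ) * K (1 / x) +
          γ * ((x ^ (-r) : ℝ) : ℂ) * (((-(x ^ 2)⁻¹ : ℝ) : ℂ) * deriv K (1 / x)) := by
      intro k K γ hk hK
      have h1 := (hK (1 / x)).hasDerivAt.scomp x hinv
      rw [Complex.real_smul] at h1
      exact (((hpow.ofReal_comp.const_mul γ).mul h1).congr_of_eventuallyEq
        ((lt_mem_nhds hx).mono fun t ht => hk t ht)).deriv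
    rw [integrableKernel, if_pos rfl, key hf hF, key hg hH, hf x hx, hg x hx, wronskianKernel]
    simp only [dslope_same]
    push_cast
    ring
  · have hne : 1 / y ≠ 1 / x := fun he => h (by simpa using he.symm)
    have hx' : (x : ℂ) ≠ 0 := by exact_mod_cast hx.ne'
    have hy' : (y : ℂ) ≠ 0 := by exact_mod_cast hy.ne'
    have hxy : (x : ℂ) - y ≠ 0 := sub_ne_zero.2 (by exact_mod_cast h)
    have hinv : (((1 / y - 1 / x)⁻¹ : ℝ) : ℂ) = x * y / (x - y) := by
      rw [div_sub_div _ _ hy.ne' hx.ne', inv_div]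
      push_cast
      ring
    rw [integrableKernel, if_neg h, hf x hx, hf y hy, hg x hx, hg y hy, wronskianKernel]
    simp only [dslope_of_ne _ hne, slope_def_module, Complex.real_smul, hinv]
    push_cast
    field_simp
    ring

/-! ### The Gamma ratio -/

/-- `Γ(N + 1 + a) / (Γ(N + 1) N^a)`. -/
def gammaRatio (a : ℝ) (N : ℕ) : ℝ :=
  Real.Gamma (N + 1 + a) / (Real.Gamma (N + 1) * (N : ℝ) ^ a)

theorem gammaRatio_add_one {a : ℝ} (ha : -1 < a) {N : ℕ} (hN : 1 ≤ N) :
    gammaRatio (a + 1) N = gammaRatio a N * (1 + (1 + a) / N) := by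
  have hN' : (0 : ℝ) < N := by exact_mod_cast hN
  have hG : Real.Gamma (N + 1) ≠ 0 := (Real.Gamma_pos_of_pos (by positivity)).ne'
  have hp : (N : ℝ) ^ a ≠ 0 := (Real.rpow_pos_of_pos hN' a).ne'
  have hne : (N : ℝ) + 1 + a ≠ 0 := by linarith
  rw [gammaRatio, gammaRatio, ← add_assoc, Real.Gamma_add_one hne, Real.rpow_add_one hN'.ne']
  field_simp
  ring

theorem abs_gammaRatio_sub_one_le_of_mem_Ioc {a : ℝ} (ha : a ∈ Ioc 0 1) {N : ℕ} (hN : 1 ≤ N) :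
    |gammaRatio a N - 1| ≤ a / N := by
  have hN' : (0 : ℝ) < N := by exact_mod_cast hN
  have hG : 0 < Real.Gamma (N + 1) := Real.Gamma_pos_of_pos (by positivity)
  have hGa : 0 < Real.Gamma (N + 1 + a) := Real.Gamma_pos_of_pos (by linarith [ha.1])
  have hp : 0 < (N : ℝ) ^ a := Real.rpow_pos_of_pos hN' a
  have hp1 : 0 < ((N : ℝ) + 1) ^ a := Real.rpow_pos_of_pos (by positivity) a
  have hfeq : ∀ {y : ℝ}, 0 < y →
      (Real.log ∘ Real.Gamma) (y + 1) = (Real.log ∘ Real.Gamma) y + Real.log y := by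
    intro y hy
    simp only [Function.comp_apply]
    rw [Real.Gamma_add_one hy.ne', Real.log_mul hy.ne' (Real.Gamma_pos_of_pos hy).ne', add_comm]
  have hle := Real.BohrMollerup.f_add_nat_le (n := N + 1) Real.convexOn_log_Gamma hfeq
    (Nat.succ_ne_zero N) ha.1 ha.2
  have hge := Real.BohrMollerup.f_add_nat_ge (n := N + 1) Real.convexOn_log_Gamma hfeq
    (by omega) ha.1
  simp only [Function.comp_apply, Nat.cast_add, Nat.cast_one, add_sub_cancel_right] at hle hge
  rw [← Real.log_rpow (by positivity), ← Real.log_mul hG.ne' (by positivity),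
    Real.log_le_log_iff (by positivity) (by positivity)] at hle hge
  have h1 : 1 ≤ gammaRatio a N := by
    rw [gammaRatio, one_le_div (by positivity)]
    exact hge
  have h2 : gammaRatio a N ≤ 1 + a / N := by
    calc gammaRatio a N ≤ Real.Gamma (N + 1) * ((N : ℝ) + 1) ^ a / (Real.Gamma (N + 1) * N ^ a) := by
          rw [gammaRatio]
          gcongr
      _ = (1 + 1 / N) ^ a := by
          rw [mul_div_mul_left _ _ hG.ne', ← Real.div_rpow (by positivity) hN'.le, add_div,
            div_self hN'.ne']
      _ ≤ 1 + a * (1 / N) := rpow_one_add_le_one_add_mul_self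
          (by linarith [one_div_pos.2 hN']) ha.1.le ha.2
      _ = 1 + a / N := by ring
  rw [abs_of_nonneg (by linarith)]
  linarith

theorem exists_abs_gammaRatio_sub_one_le {a : ℝ} (ha : -1 < a) :
    ∃ C : ℝ, ∀ N : ℕ, 1 ≤ N → |gammaRatio a N - 1| ≤ C / N := by
  have pos : ∀ n : ℕ, ∀ a : ℝ, (n : ℝ) < a → a ≤ n + 1 →
      ∃ C : ℝ, ∀ N : ℕ, 1 ≤ N → |gammaRatio a N - 1| ≤ C / N := by
    intro n
    induction n with
    | zero =>
      intro a h0 h1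
      simp only [Nat.cast_zero, zero_add] at h0 h1
      exact ⟨a, fun N hN => abs_gammaRatio_sub_one_le_of_mem_Ioc ⟨h0, h1⟩ hN⟩
    | succ n ih =>
      intro a h0 h1
      push_cast at h0 h1
      obtain ⟨C, hC⟩ := ih (a - 1) (by linarith) (by linarith)
      have ha1 : 0 ≤ a := by linarith [(Nat.cast_nonneg n : (0 : ℝ) ≤ n)]
      refine ⟨C * (1 + a) + a, fun N hN => ?_⟩
      have hN' : (1 : ℝ) ≤ N := by exact_mod_cast hN
      have e := gammaRatio_add_one (a := a - 1)
        (by linarith [(Nat.cast_nonneg n : (0 : ℝ) ≤ n)]) hN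
      rw [sub_add_cancel, add_sub_cancel] at e
      have h2 : a / N ≤ a := div_le_self ha1 hN'
      have h3 : 0 ≤ a / N := by positivity
      have h4 : gammaRatio a N - 1 = (gammaRatio (a - 1) N - 1) * (1 + a / N) + a / N := by
        rw [e]; ring
      rw [h4]
      refine (abs_add_le _ _).trans ?_
      rw [abs_mul, abs_of_nonneg (by linarith : 0 ≤ 1 + a / N), abs_of_nonneg h3, add_div,
        mul_div_right_comm]
      gcongr
      · exact (abs_nonneg _).trans (hC N hN)
      · exact hC N hN
  have pos' : ∀ a : ℝ, 0 < a → ∃ C : ℝ, ∀ N : ℕ, 1 ≤ N → |gammaRatio a N - 1| ≤ C / N := by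
    intro a h
    have h1 : 1 ≤ ⌈a⌉₊ := Nat.ceil_pos.2 h
    refine pos (⌈a⌉₊ - 1) a ?_ ?_
    · exact Nat.lt_ceil.1 (by omega)
    · push_cast [h1]
      linarith [Nat.le_ceil a]
  obtain ⟨C, hC⟩ := pos' (a + 1) (by linarith)
  refine ⟨C + (1 + a), fun N hN => ?_⟩
  have hN' : (0 : ℝ) < N := by exact_mod_cast hN
  have h3 : 0 ≤ (1 + a) / N := div_nonneg (by linarith) hN'.le
  have e := gammaRatio_add_one ha hN
  have h4 : gammaRatio a N - 1 =
      (gammaRatio (a + 1) N - 1 - (1 + a) / N) / (1 + (1 + a) / N) := by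
    rw [e, eq_div_iff (by linarith)]
    ring
  rw [h4, abs_div, abs_of_nonneg (by linarith : 0 ≤ 1 + (1 + a) / N), add_div C]
  refine (div_le_self (abs_nonneg _) (by linarith)).trans ((abs_sub _ _).trans ?_)
  rw [abs_of_nonneg h3]
  gcongr
  exact hC N hN

theorem CNs_div_rpow (s : ℂ) {N : ℕ} (hN : 1 ≤ N) :
    CNs s N * (((((N : ℝ) ^ s.re)⁻¹ : ℝ) : ℂ) * ((((N : ℝ) ^ (s.re + 1))⁻¹ : ℝ) : ℂ)) =
      gammaRatio (2 * s.re) N *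
        (cinf s * ((((2 : ℝ) ^ s.re : ℝ) : ℂ) * ((2 * (2 : ℝ) ^ s.re : ℝ) : ℂ))) := by
  have hN' : (0 : ℝ) < N := by exact_mod_cast hN
  have hNc : (N : ℂ) ≠ 0 := by exact_mod_cast hN'.ne'
  have hG : (Real.Gamma N : ℂ) ≠ 0 := by exact_mod_cast (Real.Gamma_pos_of_pos hN').ne'
  have hp : (((N : ℝ) ^ s.re : ℝ) : ℂ) ≠ 0 := by
    exact_mod_cast (Real.rpow_pos_of_pos hN' _).ne'
  have e2 : (2 : ℝ) ^ (2 * s.re) = 2 ^ s.re * 2 ^ s.re := by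
    rw [two_mul, Real.rpow_add two_pos]
  have eN : (N : ℝ) ^ (2 * s.re) = N ^ s.re * N ^ s.re := by
    rw [two_mul, Real.rpow_add hN']
  have e3 : (2 * s.re + N + 1 : ℝ) = N + 1 + 2 * s.re := by ring
  have hpi : (Real.pi : ℂ) ≠ 0 := by exact_mod_cast Real.pi_ne_zero
  rw [CNs, cinf, gammaRatio, e2, eN, e3, Real.Gamma_add_one hN'.ne', Real.rpow_add_one hN'.ne',
    Complex.Gamma_ofReal (N + 1 + 2 * s.re), ← Complex.ofReal_natCast N, Complex.Gamma_ofReal N]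
  generalize Complex.Gamma ((2 * s.re + 1 : ℝ) : ℂ) = A
  generalize Complex.Gamma ((2 * s.re + 2 : ℝ) : ℂ) = B
  push_cast
  field_simp

theorem natCast_mul_KNC (s : ℂ) (hs : -(1 / 2 : ℝ) < s.re) {N : ℕ} (hN : 1 ≤ N) {x y : ℝ}
    (hx : 0 < x) (hy : 0 < y) :
    N * KNC s N (N * x) (N * y) =
      ((((x * y) ^ (s.re + 1))⁻¹ : ℝ) : ℂ) *
        (cinf s * ((((2 : ℝ) ^ s.re : ℝ) : ℂ) * ((2 * (2 : ℝ) ^ s.re : ℝ) : ℂ)) *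
          (gammaRatio (2 * s.re) N *
            wronskianKernel (regularPart s 0 s (2 * s.re + 1) N)
              (fun u => u * regularPart s 1 (s + 1) (2 * s.re + 2) N u) (1 / x, 1 / y))) := by
  have hF := c1Rate_regularPart s zero_le_one s (c := 2 * s.re + 1) (by linarith) 0
  have hH := (c1Rate_id 0).mul
    (c1Rate_regularPart s le_rfl (s + 1) (c := 2 * s.re + 2) (by linarith) 0)
  have hN' : (N : ℝ) ≠ 0 := by positivity
  have h1 : KNC s N (N * x) (N * y) =
      CNs s N * integrableKernel (phiN s N) (psiN s N) (N * x) (N * y) := by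
    rw [KNC, integrableKernel]
    split_ifs
    · rfl
    · rw [mul_div_assoc]
  have h2 := integrableKernel_natCast_mul (phiN s N) (psiN s N) hN' x y
  rw [integrableKernel_eq_wronskianKernel (fun t ht => phiN_natCast_mul s hN ht)
    (fun t ht => psiN_natCast_mul s hN ht) (hF.differentiable N) (hH.differentiable N) hx hy] at h2
  rw [h1, mul_left_comm, ← Complex.ofReal_natCast N, h2]
  linear_combination ((((x * y) ^ (s.re + 1))⁻¹ : ℝ) : ℂ) *
    wronskianKernel (regularPart s 0 s (2 * s.re + 1) N)
      (fun u => u * regularPart s 1 (s + 1) (2 * s.re + 2) N u) (1 / x, 1 / y) *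
      CNs_div_rpow s hN

theorem KinfC_of_pos (s : ℂ) (hs : -(1 / 2 : ℝ) < s.re) {x y : ℝ} (hx : 0 < x) (hy : 0 < y) :
    KinfC s x y =
      ((((x * y) ^ (s.re + 1))⁻¹ : ℝ) : ℂ) *
        (cinf s * ((((2 : ℝ) ^ s.re : ℝ) : ℂ) * ((2 * (2 : ℝ) ^ s.re : ℝ) : ℂ)) *
          (1 * wronskianKernel (regularLimit s s (2 * s.re + 1))
              (fun u => u * regularLimit s (s + 1) (2 * s.re + 2) u) (1 / x, 1 / y))) := by
  have hF := c1Rate_regularPart s zero_le_one s (c := 2 * s.re + 1) (by linarith) 0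
  have hH := (c1Rate_id 0).mul
    (c1Rate_regularPart s le_rfl (s + 1) (c := 2 * s.re + 2) (by linarith) 0)
  have h1 : KinfC s x y = cinf s * integrableKernel (Ptilde s) (Qfun s) x y := by
    rw [KinfC, integrableKernel]
    split_ifs
    · rfl
    · rw [mul_div_assoc]
  rw [h1, integrableKernel_eq_wronskianKernel (fun t ht => Ptilde_of_pos s ht)
    (fun t ht => Qfun_of_pos s ht) hF.differentiable_limit hH.differentiable_limit hx hy]
  ring

theorem uniformRate_gammaRatio {α : Type*} (S : Set α) {a : ℝ} (ha : -1 < a) :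
    UniformRate S (fun N _ => (gammaRatio a N : ℂ)) (fun _ => 1) := by
  obtain ⟨C, hC⟩ := exists_abs_gammaRatio_sub_one_le ha
  refine UniformRate.of_bound (C := C) (D := 1) (fun N hN _ _ => ?_) (fun _ _ => by simp)
  rw [← Complex.ofReal_one, ← Complex.ofReal_sub, Complex.norm_real]
  exact hC N hN

/-- Rate of convergence for the rescaled kernel: for `Re(s) > −1/2` and
every `x₀ > 0` there is a constant `C(x₀,s) > 0` such that for all `N ≥ 1` and `x, y > x₀`,
`|K_[N](x,y) − K_∞(x,y)| ≤ (1/N) C(x₀,s)/(xy)^{Re(s)+1}`. -/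
theorem Kscaled_rate_of_convergence (s : ℂ) (hs : -(1 / 2 : ℝ) < s.re)
    (x₀ : ℝ) (hx₀ : 0 < x₀) :
    ∃ C : ℝ, 0 < C ∧ ∀ N : ℕ, 1 ≤ N → ∀ x y : ℝ, x₀ < x → x₀ < y →
      |Kscaled s N x y - Kinf s x y| ≤ (1 / N) * (C / (x * y) ^ (s.re + 1)) := by
  have hF := c1Rate_regularPart s zero_le_one s (c := 2 * s.re + 1) (by linarith) (1 / x₀)
  have hH := (c1Rate_id (1 / x₀)).mul
    (c1Rate_regularPart s le_rfl (s + 1) (c := 2 * s.re + 2) (by linarith) (1 / x₀))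
  obtain ⟨C, hC, h⟩ := ((uniformRate_gammaRatio _ (by linarith : -1 < 2 * s.re)).mul
    (hF.wronskianKernel hH)).const_mul
      (cinf s * ((((2 : ℝ) ^ s.re : ℝ) : ℂ) * ((2 * (2 : ℝ) ^ s.re : ℝ) : ℂ)))
  refine ⟨C + 1, by positivity, fun N hN x y hx hy => ?_⟩
  have hx0 : 0 < x := hx₀.trans hx
  have hy0 : 0 < y := hx₀.trans hy
  have hmem : ((1 / x, 1 / y) : ℝ × ℝ) ∈ Icc 0 (1 / x₀) ×ˢ Icc 0 (1 / x₀) :=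
    ⟨⟨by positivity, one_div_le_one_div_of_le hx₀ hx.le⟩,
      ⟨by positivity, one_div_le_one_div_of_le hx₀ hy.le⟩⟩
  have e : Kscaled s N x y - Kinf s x y =
      (N * KNC s N (N * x) (N * y) - KinfC s x y).re := by
    rw [Complex.sub_re, ← Complex.ofReal_natCast N, Complex.re_ofReal_mul]
    rfl
  have hpow : 0 < (x * y) ^ (s.re + 1) := by positivity
  rw [e, natCast_mul_KNC s hs hN hx0 hy0, KinfC_of_pos s hs hx0 hy0, ← mul_sub]
  refine (Complex.abs_re_le_norm _).trans ?_
  rw [norm_mul, Complex.norm_real, Real.norm_of_nonneg (by positivity)]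
  calc _ ≤ ((x * y) ^ (s.re + 1))⁻¹ * (C / N) := by
        gcongr
        exact (h N hN _ hmem).1
    _ ≤ ((x * y) ^ (s.re + 1))⁻¹ * ((C + 1) / N) := by
        gcongr
        linarith
    _ = _ := by ring
end
end
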